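/- arXiv:1510.01349 — 2 statements merged into one kernel-verified Lean document; each statement's English description precedes it below -/
import Mathlib

section
/- Let m, n_1, n_2, p, q be positive integers, c a vector of n_2 polynomials with integer coefficients, A_1 a q × (n_1+n_2) matrix with constant integer entries, A_2 a p × n_2 matrix of polynomials with integer coefficients, b_2 a vector of p such polynomials, 𝔖 a finite set, and for each α ∈ 𝔖 let b(α) be a vector of q polynomials with integer coefficients. For each positive integer t let R_2(t) = {y₂ ∈ ℝ^{n_2} : A_2(t)y₂ ≤ b_2(t)} and, for each α ∈ 𝔖, K(α,t) = {y ∈ {0, …, t−1}^{n_1+n_2} : A_1 y = b(α)(t)}. Assume that for every t, R_2(t) ⊆ [0, t−1]^{n_2} and the sets K(α,t), α ∈ 𝔖, are pairwise disjoint. Let L_2(t) = R_2(t) ∩ ℤ^{n_2} and L_3(t) = {y₂ ∈ L_2(t) : the number of y₃ ∈ {0, …, t−1}^{n_1} with (y₂, y₃) ∈ ⋃_{α ∈ 𝔖} K(α,t) is less than m}, where (y₂, y₃) is the concatenated vector with y₂ in the first n_2 coordinates. For each positive integer ℓ, let f_ℓ(t) be the ℓ-th largest value with multiplicity of c(t)·y₂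 over y₂ ∈ L_3(t), or −∞ if |L_3(t)| < ℓ. Then for every ℓ, f_ℓ is eventually quasi-polynomial. -/
/-- Evaluation of an integer polynomial at a positive integer `t`. -/
def evalAt (p : Polynomial ℤ) (t : ℕ) : ℤ := p.eval (t : ℤ)

/-- Eventual quasi-polynomiality for functions with values in `ℤ ∪ {−∞}`. -/
def IsEQPBot (f : ℕ → WithBot ℤ) : Prop :=
  ∃ d : ℕ, 0 < d ∧ ∀ r : ℕ, r < d →
    (∃ R : Polynomial ℚ, ∃ N : ℕ, ∀ t : ℕ, N ≤ t → t % d = r →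
      ∃ z : ℤ, f t = (z : WithBot ℤ) ∧ (z : ℚ) = R.eval (t : ℚ)) ∨
    (∃ N : ℕ, ∀ t : ℕ, N ≤ t → t % d = r → f t = ⊥)

/-- `v` is the `ℓ`-th largest value, with multiplicity, of `obj` over `S`
(`v = ⊥` when `S` has fewer than `ℓ` elements). -/
def IsKthLargest {α : Type*} (S : Set α) (obj : α → ℤ) (ℓ : ℕ) (v : WithBot ℤ) : Prop :=
  (S.ncard < ℓ ∧ v = ⊥) ∨
  (ℓ ≤ S.ncard ∧ ∃ z : ℤ, v = (z : WithBot ℤ) ∧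
    {x ∈ S | z < obj x}.ncard < ℓ ∧ ℓ ≤ {x ∈ S | z ≤ obj x}.ncard)

/-- `K(α,t) = {y ∈ {0,…,t−1}^{n₁+n₂} : A₁ y = b(α)(t)}`, where the `Fin n₂` block
consists of the first `n₂` coordinates. -/
def Kset {n1 n2 q : ℕ} (A1 : Matrix (Fin q) (Fin n2 ⊕ Fin n1) ℤ)
    (bα : Fin q → Polynomial ℤ) (t : ℕ) : Set ((Fin n2 ⊕ Fin n1) → ℤ) :=
  {y | (∀ j, 0 ≤ y j ∧ y j ≤ (t : ℤ) - 1) ∧ ∀ i, ∑ j, A1 i j * y j = evalAt (bα i) t}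

/-- Lattice points of `R₂(t) = {y₂ : A₂(t) y₂ ≤ b₂(t)}`. -/
def latticeL2 {n2 p : ℕ} (A2 : Matrix (Fin p) (Fin n2) (Polynomial ℤ))
    (b2 : Fin p → Polynomial ℤ) (t : ℕ) : Set (Fin n2 → ℤ) :=
  {y2 | ∀ i, ∑ j, evalAt (A2 i j) t * y2 j ≤ evalAt (b2 i) t}

/-- `L₃(t)`: points of `L₂(t)` which are the image of fewer than `m` points
of `⋃_α K(α,t)` under projection to the first `n₂` coordinates. -/
noncomputable def latticeL3K {n1 n2 p q : ℕ} (m : ℕ) {S : Type*}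
    (A1 : Matrix (Fin q) (Fin n2 ⊕ Fin n1) ℤ) (bb : S → Fin q → Polynomial ℤ)
    (A2 : Matrix (Fin p) (Fin n2) (Polynomial ℤ)) (b2 : Fin p → Polynomial ℤ)
    (t : ℕ) : Set (Fin n2 → ℤ) :=
  {y2 ∈ latticeL2 A2 b2 t |
    {y3 : Fin n1 → ℤ | (∀ j, 0 ≤ y3 j ∧ y3 j ≤ (t : ℤ) - 1) ∧
      ∃ α : S, Sum.elim y2 y3 ∈ Kset A1 (bb α) t}.ncard < m}

/-- A predicate on tuples of naturals whose set of solutions is semilinear. -/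
def Sl {ι : Type} (p : (ι → ℕ) → Prop) : Prop := IsSemilinearSet {x : ι → ℕ | p x}

lemma Sl.and {ι : Type} {p q : (ι → ℕ) → Prop} (hp : Sl p) (hq : Sl q) :
    Sl (fun x => p x ∧ q x) := IsSemilinearSet.inter hp hq

lemma Sl.or {ι : Type} {p q : (ι → ℕ) → Prop} (hp : Sl p) (hq : Sl q) :
    Sl (fun x => p x ∨ q x) := IsSemilinearSet.union hp hq

lemma Sl.not {ι : Type} [Finite ι] {p : (ι → ℕ) → Prop} (hp : Sl p) :
    Sl (fun x => ¬ p x) := IsSemilinearSet.compl hp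

lemma Sl.congr {ι : Type} {p q : (ι → ℕ) → Prop} (hp : Sl p) (h : ∀ x, q x ↔ p x) :
    Sl q := by
  have : q = p := funext fun x => propext (h x)
  rw [this]; exact hp

lemma Sl.all {ι κ : Type} [Finite ι] [Finite κ] {p : κ → (ι → ℕ) → Prop}
    (hp : ∀ k, Sl (p k)) : Sl (fun x => ∀ k, p k x) := by
  have h := IsSemilinearSet.iInter hp
  unfold Sl
  convert h using 1
  ext x; simp

lemma Sl.ex {ι κ : Type} [Finite κ] {p : κ → (ι → ℕ) → Prop}
    (hp : ∀ k, Sl (p k)) : Sl (fun x => ∃ k, p k x) := by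
  have h := IsSemilinearSet.iUnion hp
  unfold Sl
  convert h using 1
  ext x; simp

lemma Sl.comp {ι κ : Type} [Finite ι] {p : (κ → ℕ) → Prop}
    (hp : Sl p) (g : κ → ι) : Sl (fun x : ι → ℕ => p (fun k => x (g k))) :=
  IsSemilinearSet.preimage hp (LinearMap.funLeft ℕ ℕ g)

lemma Sl.proj {ι κ : Type} {p : (ι → ℕ) → (κ → ℕ) → Prop}
    (hp : Sl (fun x : ι ⊕ κ → ℕ => p (fun i => x (Sum.inl i)) (fun k => x (Sum.inr k)))) :
    Sl (fun x => ∃ y, p x y) := IsSemilinearSet.proj' hp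

lemma Sl.lin {ι : Type} [Fintype ι] (a : ι → ℤ) (b : ℤ) :
    Sl (fun x : ι → ℕ => ∑ j, a j * (x j : ℤ) ≤ b) := by
  let f : (ι ⊕ Unit → ℕ) →+ ℤ :=
    { toFun := fun v => ∑ j, a j * (v (Sum.inl j) : ℤ) + v (Sum.inr ())
      map_zero' := by simp
      map_add' := by
        intro u v
        simp only [Pi.add_apply, Nat.cast_add, mul_add, Finset.sum_add_distrib]
        ring }
  have h : Sl (fun v : ι ⊕ Unit → ℕ => (0 : ℤ) + f v = b + (0 : (ι ⊕ Unit → ℕ) →+ ℤ) v) :=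
    isSemilinearSet_setOfPred_eq 0 b f 0
  have h2 : Sl (fun x : ι → ℕ => ∃ y : Unit → ℕ, ∑ j, a j * (x j : ℤ) + (y () : ℤ) = b) := by
    apply Sl.proj
    refine h.congr fun x => ?_
    simp [f]
  refine h2.congr fun x => ?_
  constructor
  · intro hx
    exact ⟨fun _ => (b - ∑ j, a j * (x j : ℤ)).toNat, by
      rw [Int.toNat_of_nonneg (by linarith)]; ring⟩
  · rintro ⟨y, hy⟩
    have : (0 : ℤ) ≤ y () := Int.natCast_nonneg _
    linarith

lemma Sl.coordLe {ι : Type} [Fintype ι] (i j : ι) : Sl (fun x : ι → ℕ => x i ≤ x j) := by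
  classical
  refine (Sl.lin (fun k => (if k = i then 1 else 0) - (if k = j then 1 else 0)) 0).congr
    fun x => ?_
  simp [sub_mul, Finset.sum_sub_distrib]

lemma Sl.coordLt {ι : Type} [Fintype ι] (i j : ι) : Sl (fun x : ι → ℕ => x i < x j) :=
  (Sl.coordLe j i).not.congr fun x => by simp

lemma Sl.coordPos {ι : Type} [Fintype ι] (i : ι) : Sl (fun x : ι → ℕ => 0 < x i) := by
  classical
  refine (Sl.lin (fun k => - (if k = i then 1 else 0)) (-1)).congr fun x => ?_
  simp
  omega

lemma key_carry (t e q X : ℤ) (ht : 0 < t) (h1 : q * t ≤ e) (h2 : e < (q + 1) * t) :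
    e + t * X ≤ 0 ↔ (X + q ≤ -1 ∨ (X + q ≤ 0 ∧ e ≤ q * t)) := by
  constructor
  · intro h
    have h3 : (X + q) * t ≤ 0 := by nlinarith
    have h4 : X + q ≤ 0 := by
      by_contra hc
      push Not at hc
      nlinarith
    rcases h4.lt_or_eq with h5 | h5
    · left; omega
    · right
      refine ⟨h4, ?_⟩
      have : X = -q := by linarith
      subst this
      linarith
  · rintro (h | ⟨h, h'⟩)
    · nlinarith
    · nlinarith

open Polynomial in
lemma Sl.poly {ι : Type} [Fintype ι] (τ : ι) (N : ℕ) : ∀ (a : ι → ℤ[X]) (b : ℤ[X]),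
    (∀ j, (a j).natDegree ≤ N) → b.natDegree ≤ N →
    Sl (fun x : ι → ℕ => (0 < x τ ∧ ∀ j, x j ≤ x τ) ∧
      ∑ j, (a j).eval (x τ : ℤ) * (x j : ℤ) ≤ b.eval (x τ : ℤ)) := by
  classical
  have hD : Sl (fun x : ι → ℕ => 0 < x τ ∧ ∀ j, x j ≤ x τ) :=
    (Sl.coordPos τ).and (Sl.all fun j => Sl.coordLe j τ)
  induction N with
  | zero =>
    intro a b ha hb
    refine hD.and ((Sl.lin (fun j => (a j).coeff 0) (b.coeff 0)).congr fun x => ?_)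
    have hb' := eq_C_of_natDegree_le_zero hb
    have ha' := fun j => eq_C_of_natDegree_le_zero (ha j)
    rw [hb']
    simp only [eval_C, coeff_C_zero]
    have : ∀ j, (a j).eval (x τ : ℤ) = (a j).coeff 0 := fun j => by
      conv_lhs => rw [ha' j]
      simp
    simp only [this]
  | succ N ih =>
    intro a b ha hb
    have hdiv : ∀ p : ℤ[X], p.natDegree ≤ N + 1 → p.divX.natDegree ≤ N := by
      intro p hp
      rw [natDegree_divX_eq_natDegree_tsub_one]; omega
    have hdivb : ∀ q : ℤ, (b.divX - C q).natDegree ≤ N := by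
      intro q
      refine (natDegree_sub_le _ _).trans ?_
      simp [hdiv b hb]
    -- the bound on carries
    let Cc : ℤ := ∑ j, |(a j).coeff 0| + |b.coeff 0|
    have main : ∀ q : Finset.Icc (-Cc-1) Cc, Sl (fun x : ι → ℕ =>
        (¬ (∑ j, ((if j = τ then -(q:ℤ) else 0) + (a j).coeff 0) * (x j : ℤ) ≤ b.coeff 0 - 1) ∧
          ∑ j, ((if j = τ then -((q:ℤ) + 1) else 0) + (a j).coeff 0) * (x j : ℤ) ≤ b.coeff 0 - 1)
        ∧ (((0 < x τ ∧ ∀ j, x j ≤ x τ) ∧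
            ∑ j, (a j).divX.eval (x τ : ℤ) * (x j : ℤ) ≤ (b.divX - C ((q:ℤ) + 1)).eval (x τ : ℤ)) ∨
          (((0 < x τ ∧ ∀ j, x j ≤ x τ) ∧
            ∑ j, (a j).divX.eval (x τ : ℤ) * (x j : ℤ) ≤ (b.divX - C (q:ℤ)).eval (x τ : ℤ)) ∧
            ∑ j, ((if j = τ then -(q:ℤ) else 0) + (a j).coeff 0) * (x j : ℤ) ≤ b.coeff 0))) := by
      intro q
      refine ((Sl.lin _ _).not.and (Sl.lin _ _)).and (Sl.or ?_ (Sl.and ?_ (Sl.lin _ _)))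
      · exact ih _ _ (fun j => hdiv _ (ha j)) (hdivb _)
      · exact ih _ _ (fun j => hdiv _ (ha j)) (hdivb _)
    refine (hD.and (Sl.ex main)).congr fun x => ?_
    refine and_congr_right fun hx => ?_
    obtain ⟨hpos, hle⟩ := hx
    set t : ℤ := (x τ : ℤ) with ht
    have htpos : 0 < t := by simp only [ht]; exact_mod_cast hpos
    set e : ℤ := ∑ j, (a j).coeff 0 * (x j : ℤ) - b.coeff 0 with he
    set X' : ℤ := ∑ j, (a j).divX.eval t * (x j : ℤ) - b.divX.eval t with hX
    have hs : ∀ q : ℤ, ∑ j, ((if j = τ then q else 0) + (a j).coeff 0) * (x j : ℤ)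
        = q * t + e + b.coeff 0 := by
      intro q
      simp only [add_mul, Finset.sum_add_distrib, ite_mul, zero_mul, Finset.sum_ite_eq',
        Finset.mem_univ, if_true, he, ht]
      ring
    have hev : ∀ p : ℤ[X], p.eval t = p.coeff 0 + t * p.divX.eval t := by
      intro p
      conv_lhs => rw [← divX_mul_X_add p]
      simp; ring
    have htot : (∑ j, (a j).eval t * (x j : ℤ) ≤ b.eval t) ↔ e + t * X' ≤ 0 := by
      have : ∑ j, (a j).eval t * (x j : ℤ) - b.eval t = e + t * X' := by
        rw [he, hX, hev b, Finset.sum_congr rfl (fun j _ => by rw [hev (a j)])]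
        simp only [add_mul, Finset.sum_add_distrib, mul_sub, Finset.mul_sum, mul_assoc]
        ring
      rw [← this]; constructor <;> intro h <;> linarith
    have hbound : |e| ≤ Cc * t := by
      have h1 : |∑ j, (a j).coeff 0 * (x j : ℤ)| ≤ ∑ j, |(a j).coeff 0| * t := by
        refine (Finset.abs_sum_le_sum_abs _ _).trans (Finset.sum_le_sum fun j _ => ?_)
        rw [abs_mul]
        refine mul_le_mul_of_nonneg_left ?_ (abs_nonneg _)
        rw [abs_of_nonneg (Int.natCast_nonneg _)]
        simp only [ht]; exact_mod_cast hle j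
      have h2 : |b.coeff 0| ≤ |b.coeff 0| * t := by
        have := abs_nonneg (b.coeff 0)
        nlinarith
      calc |e| ≤ |∑ j, (a j).coeff 0 * (x j : ℤ)| + |b.coeff 0| := abs_sub _ _
        _ ≤ Cc * t := by simp only [Cc, add_mul, Finset.sum_mul]; linarith
    simp only [hs, eval_sub, eval_C]
    rw [htot]
    have hq : ∀ q : ℤ, q * t ≤ e → e < (q + 1) * t → (e + t * X' ≤ 0 ↔
        (X' + q ≤ -1 ∨ (X' + q ≤ 0 ∧ e ≤ q * t))) := fun q => key_carry t e q X' htpos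
    constructor
    · intro h
      have h1 : e / t * t ≤ e := Int.ediv_mul_le _ htpos.ne'
      have h2 : e < (e / t + 1) * t := Int.lt_ediv_add_one_mul_self _ htpos
      rw [abs_le] at hbound
      have h3 : -Cc - 1 ≤ e / t := by
        by_contra hc; push Not at hc
        nlinarith
      have h4 : e / t ≤ Cc := by
        by_contra hc; push Not at hc
        nlinarith
      refine ⟨⟨e / t, Finset.mem_Icc.2 ⟨h3, h4⟩⟩, ⟨by simp only; linarith, by simp only; linarith⟩, ?_⟩
      rcases (hq _ h1 h2).1 h with h5 | ⟨h5, h6⟩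
      · left; exact ⟨⟨hpos, hle⟩, by simp only; linarith⟩
      · right; exact ⟨⟨⟨hpos, hle⟩, by simp only; linarith⟩, by simp only; linarith⟩
    · rintro ⟨⟨q, _⟩, ⟨h1, h2⟩, h⟩
      simp only at h1 h2 h
      refine (hq q (by linarith) (by linarith)).2 ?_
      rcases h with ⟨_, h⟩ | ⟨⟨_, h⟩, h'⟩
      · left; linarith
      · right; exact ⟨by linarith, by linarith⟩

open Polynomial in
lemma Sl.poly' {ι : Type} [Fintype ι] (τ : ι) (a : ι → ℤ[X]) (b : ℤ[X]) :
    Sl (fun x : ι → ℕ => (0 < x τ ∧ ∀ j, x j ≤ x τ) ∧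
      ∑ j, (a j).eval (x τ : ℤ) * (x j : ℤ) ≤ b.eval (x τ : ℤ)) := by
  refine Sl.poly τ (∑ j, (a j).natDegree + b.natDegree) a b (fun j => ?_) (by omega)
  have := Finset.single_le_sum (f := fun j => (a j).natDegree) (fun i _ => Nat.zero_le _)
    (Finset.mem_univ j)
  omega

lemma Sl.count {ι κ : Type} [Fintype ι] [Fintype κ] {p : (ι → ℕ) → (κ → ℕ) → Prop} (m : ℕ)
    (hp : Sl (fun x : ι ⊕ κ → ℕ => p (fun i => x (Sum.inl i)) (fun k => x (Sum.inr k))))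
    (hfin : ∀ x, {y | p x y}.Finite) :
    Sl (fun x => m ≤ {y | p x y}.ncard) := by
  have h : Sl (fun x : ι → ℕ => ∃ z : Fin m × κ → ℕ, (∀ i, p x (fun k => z (i, k))) ∧
      ∀ i j : Fin m, i = j ∨ ¬ ∀ k, z (i, k) ≤ z (j, k) ∧ z (j, k) ≤ z (i, k)) := by
    apply Sl.proj
    refine (Sl.all fun i => ?_).and (Sl.all fun i => Sl.all fun j => ?_)
    · exact hp.comp (Sum.elim Sum.inl (fun k => Sum.inr (i, k)))
    · by_cases hij : i = j
      · refine (Sl.lin (fun _ => 0) 0).congr fun x => ?_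
        simp [hij]
      · refine (Sl.not (Sl.all fun k => (Sl.coordLe (Sum.inr (i, k)) (Sum.inr (j, k))).and
          (Sl.coordLe (Sum.inr (j, k)) (Sum.inr (i, k))))).congr fun x => ?_
        simp [hij]
  refine h.congr fun x => ?_
  constructor
  · intro hm
    obtain ⟨s, hs, hc⟩ := Set.exists_subset_card_eq hm
    have hsf : s.Finite := (hfin x).subset hs
    have e := Finset.equivFinOfCardEq (s := hsf.toFinset) (n := m)
      (by rw [← hc, Set.ncard_eq_toFinset_card s hsf])
    refine ⟨fun q => (e.symm q.1).1 q.2, fun i => ?_, fun i j => ?_⟩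
    · have := (e.symm i).2
      rw [Set.Finite.mem_toFinset] at this
      exact hs this
    · by_cases hij : i = j
      · exact Or.inl hij
      · right
        intro hk
        apply hij
        apply e.symm.injective
        apply Subtype.ext
        funext k
        exact le_antisymm (hk k).1 (hk k).2
  · rintro ⟨z, hz, hne⟩
    let g : Fin m → (κ → ℕ) := fun i k => z (i, k)
    have hg : Function.Injective g := by
      intro i j hij
      rcases hne i j with h | h
      · exact h
      · exact absurd (fun k => ⟨(congrFun hij k).le, (congrFun hij k).ge⟩) h
    have h1 : (Set.range g) ⊆ {y | p x y} := by
      rintro _ ⟨i, rfl⟩; exact hz i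
    have h2 := Set.ncard_le_ncard h1 (hfin x)
    rw [← Set.image_univ, Set.ncard_image_of_injective _ hg, Set.ncard_univ] at h2
    simpa using h2

lemma linear_period {ι : Type} (τ : ι) {L : Set (ι → ℕ)} (hL : IsLinearSet L) :
    ∃ d : ℕ, 0 < d ∧ ∃ N : ℕ, ∀ x ∈ L, N < x τ → ∃ v : ι → ℕ, v τ = d ∧
      ∀ n : ℕ, x + n • v ∈ L := by
  obtain ⟨b, T, _, rfl⟩ := hL
  by_cases h : ∃ p ∈ T, 0 < p τ
  · obtain ⟨p, hp, hpos⟩ := h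
    refine ⟨p τ, hpos, 0, fun x hx _ => ⟨p, rfl, fun n => ?_⟩⟩
    rw [Set.mem_vadd_set] at hx ⊢
    obtain ⟨y, hy, rfl⟩ := hx
    refine ⟨y + n • p, ?_, by simp [add_assoc]⟩
    exact add_mem hy (nsmul_mem (AddSubmonoid.subset_closure hp) n)
  · push Not at h
    refine ⟨1, one_pos, b τ, fun x hx hlt => ?_⟩
    exfalso
    rw [Set.mem_vadd_set] at hx
    obtain ⟨y, hy, rfl⟩ := hx
    have : y τ = 0 := by
      induction hy using AddSubmonoid.closure_induction with
      | mem y hy => exact Nat.le_zero.1 (h y hy)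
      | zero => rfl
      | add u v _ _ hu hv =>
        have hu' := hu
        have hv' := hv
        simp only [vadd_eq_add, Pi.add_apply] at hu' hv' hlt ⊢
        by_cases h1 : b τ < b τ + u τ
        · have := hu' h1; omega
        · by_cases h2 : b τ < b τ + v τ
          · have := hv' h2; omega
          · omega
    simp [this] at hlt

lemma semilinear_period {ι : Type} (τ : ι) {L : Set (ι → ℕ)} (hL : IsSemilinearSet L) :
    ∃ d : ℕ, 0 < d ∧ ∃ N : ℕ, ∀ x ∈ L, N < x τ → ∃ v : ι → ℕ, v τ = d ∧
      ∀ n : ℕ, x + n • v ∈ L := by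
  obtain ⟨S, hS, hlin, rfl⟩ := hL
  induction S, hS using Set.Finite.induction_on with
  | empty => exact ⟨1, one_pos, 0, by simp⟩
  | @insert A S _ _ ih =>
    obtain ⟨d1, hd1, N1, h1⟩ := linear_period τ (hlin A (Set.mem_insert _ _))
    obtain ⟨d2, hd2, N2, h2⟩ := ih (fun t ht => hlin t (Set.mem_insert_of_mem _ ht))
    refine ⟨d1 * d2, Nat.mul_pos hd1 hd2, max N1 N2, fun x hx hlt => ?_⟩
    rw [Set.sUnion_insert] at hx ⊢
    rcases hx with hx | hx
    · obtain ⟨v, hv, hn⟩ := h1 x hx (lt_of_le_of_lt (le_max_left _ _) hlt)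
      refine ⟨d2 • v, by simp [hv, mul_comm], fun n => Or.inl ?_⟩
      rw [smul_smul]; exact hn _
    · obtain ⟨v, hv, hn⟩ := h2 x hx (lt_of_le_of_lt (le_max_right _ _) hlt)
      refine ⟨d1 • v, by simp [hv], fun n => Or.inr ?_⟩
      rw [smul_smul]; exact hn _

open Polynomial in
lemma eqp_of_semilinear {n : ℕ} (c : Fin n → ℤ[X]) (M : (Unit ⊕ Fin n → ℕ) → Prop)
    (hM : Sl M) (f : ℕ → WithBot ℤ)
    (h1 : ∀ t : ℕ, 0 < t → f t ≠ ⊥ → ∃ x, M x ∧ x (Sum.inl ()) = t)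
    (h2 : ∀ x, M x → f (x (Sum.inl ())) =
      ((∑ j, evalAt (c j) (x (Sum.inl ())) * (x (Sum.inr j) : ℤ) : ℤ) : WithBot ℤ)) :
    IsEQPBot f := by
  obtain ⟨d, hd, N, hN⟩ := semilinear_period (Sum.inl () : Unit ⊕ Fin n) hM
  refine ⟨d, hd, fun r _ => ?_⟩
  by_cases h : ∃ t : ℕ, N < t ∧ t % d = r ∧ f t ≠ ⊥
  · left
    obtain ⟨t0, ht0, hr, hne⟩ := h
    obtain ⟨x, hx, hxt⟩ := h1 t0 (by omega) hne
    obtain ⟨v, hv, hn⟩ := hN x hx (by omega)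
    refine ⟨∑ j, (c j).map (Int.castRingHom ℚ) *
      (C (x (Sum.inr j) : ℚ) + C ((v (Sum.inr j) : ℚ) / d) * (X - C (t0 : ℚ))), t0,
      fun t ht htr => ?_⟩
    have hmod : t0 ≡ t [MOD d] := by rw [Nat.ModEq, hr, htr]
    obtain ⟨k, hk⟩ := (Nat.modEq_iff_dvd' ht).1 hmod
    have htk : t = t0 + k * d := by rw [mul_comm] at hk; omega
    have hz := h2 _ (hn k)
    have hτ : (x + k • v) (Sum.inl ()) = t := by simp [hxt, hv, htk]
    rw [hτ] at hz
    refine ⟨_, hz, ?_⟩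
    have hd' : (d : ℚ) ≠ 0 := by exact_mod_cast hd.ne'
    have htq : (t : ℚ) - t0 = k * d := by rw [htk]; push_cast; ring
    rw [eval_finsetSum]
    push_cast
    refine Finset.sum_congr rfl fun j _ => ?_
    have hev : ((evalAt (c j) t : ℤ) : ℚ) = ((c j).map (Int.castRingHom ℚ)).eval (t : ℚ) := by
      have := Polynomial.eval_map_apply (f := Int.castRingHom ℚ) (p := c j) (t : ℤ)
      simp only [eq_intCast, Int.cast_natCast] at this
      rw [this]; rfl
    rw [eval_mul, ← hev]
    simp only [eval_add, eval_mul, eval_sub, eval_C, eval_X, htq]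
    simp only [Pi.add_apply, Pi.smul_apply, smul_eq_mul]
    push_cast
    field_simp
  · right
    push Not at h
    exact ⟨N + 1, fun t ht htr => h t (by omega) htr⟩

lemma kth_char {α : Type*} (S : Set α) (hS : S.Finite) (obj : α → ℤ) (ℓ : ℕ)
    (v : WithBot ℤ) (h : IsKthLargest S obj ℓ v) :
    (v ≠ ⊥ → ∃ x ∈ S, {y ∈ S | obj x < obj y}.ncard < ℓ ∧ ℓ ≤ {y ∈ S | obj x ≤ obj y}.ncard) ∧
    (∀ x ∈ S, {y ∈ S | obj x < obj y}.ncard < ℓ → ℓ ≤ {y ∈ S | obj x ≤ obj y}.ncard →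
      v = ((obj x : ℤ) : WithBot ℤ)) := by
  have mono : ∀ {A B : Set α}, A ⊆ B → B ⊆ S → A.ncard ≤ B.ncard :=
    fun hAB hB => Set.ncard_le_ncard hAB (hS.subset hB)
  rcases h with ⟨hlt, rfl⟩ | ⟨hle, z, rfl, hz1, hz2⟩
  · refine ⟨fun h => absurd rfl h, fun x hx _ h2 => ?_⟩
    have := mono (A := {y ∈ S | obj x ≤ obj y}) (B := S) (fun y hy => hy.1) subset_rfl
    omega
  · constructor
    · intro _
      have : ∃ x ∈ S, obj x = z := by
        by_contra hc
        push Not at hc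
        have := mono (A := {y ∈ S | z ≤ obj y}) (B := {y ∈ S | z < obj y})
          (fun y hy => ⟨hy.1, lt_of_le_of_ne hy.2 (hc y hy.1).symm⟩) (fun y hy => hy.1)
        omega
      obtain ⟨x, hx, rfl⟩ := this
      exact ⟨x, hx, hz1, hz2⟩
    · intro x hx h1 h2
      congr 1
      rcases lt_trichotomy z (obj x) with h | h | h
      · have := mono (A := {y ∈ S | obj x ≤ obj y}) (B := {y ∈ S | z < obj y})
          (fun y hy => ⟨hy.1, lt_of_lt_of_le h hy.2⟩) (fun y hy => hy.1)
        omega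
      · exact h
      · have := mono (A := {y ∈ S | z ≤ obj y}) (B := {y ∈ S | obj x < obj y})
          (fun y hy => ⟨hy.1, lt_of_lt_of_le h hy.2⟩) (fun y hy => hy.1)
        omega

/-- Concatenation of the parameter `t` with a vector. -/
def tv {n : ℕ} (t : ℕ) (y : Fin n → ℕ) : Unit ⊕ Fin n → ℕ := Sum.elim (fun _ => t) y

/-- Solutions `z` over `x = (t, y₂)` of the systems `A₁ (y₂, z) = b(α)(t)`. -/
def Qn {n1 n2 q : ℕ} {S : Type} (A1 : Matrix (Fin q) (Fin n2 ⊕ Fin n1) ℤ)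
    (bb : S → Fin q → Polynomial ℤ) (x : Unit ⊕ Fin n2 → ℕ) (z : Fin n1 → ℕ) : Prop :=
  ((0 < x (Sum.inl ()) ∧ ∀ j, x (Sum.inr j) < x (Sum.inl ())) ∧ ∀ j, z j < x (Sum.inl ())) ∧
  ∃ α : S, ∀ i, ∑ j, A1 i (Sum.inl j) * (x (Sum.inr j) : ℤ) + ∑ j, A1 i (Sum.inr j) * (z j : ℤ)
    = evalAt (bb α i) (x (Sum.inl ()))

/-- Natural-number version of membership in `L₃(t)`. -/
def L3n {n1 n2 p q : ℕ} (m : ℕ) {S : Type} (A1 : Matrix (Fin q) (Fin n2 ⊕ Fin n1) ℤ)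
    (bb : S → Fin q → Polynomial ℤ) (A2 : Matrix (Fin p) (Fin n2) (Polynomial ℤ))
    (b2 : Fin p → Polynomial ℤ) (x : Unit ⊕ Fin n2 → ℕ) : Prop :=
  (0 < x (Sum.inl ()) ∧ ∀ j, x (Sum.inr j) < x (Sum.inl ())) ∧
  (∀ i, ∑ j, evalAt (A2 i j) (x (Sum.inl ())) * (x (Sum.inr j) : ℤ)
    ≤ evalAt (b2 i) (x (Sum.inl ()))) ∧
  ¬ m ≤ {z | Qn A1 bb x z}.ncard

lemma finite_lt {n : ℕ} (t : ℕ) : {y : Fin n → ℕ | ∀ j, y j < t}.Finite :=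
  (Set.finite_Iic (fun _ : Fin n => t)).subset fun y hy j => (hy j).le

lemma sl_Qn {n1 n2 q : ℕ} {S : Type} [Fintype S] (A1 : Matrix (Fin q) (Fin n2 ⊕ Fin n1) ℤ)
    (bb : S → Fin q → Polynomial ℤ) :
    Sl (fun x : (Unit ⊕ Fin n2) ⊕ Fin n1 → ℕ =>
      Qn A1 bb (fun i => x (Sum.inl i)) (fun k => x (Sum.inr k))) := by
  have hD : Sl (fun x : (Unit ⊕ Fin n2) ⊕ Fin n1 → ℕ =>
      (0 < x (Sum.inl (Sum.inl ())) ∧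
        ∀ j, x (Sum.inl (Sum.inr j)) < x (Sum.inl (Sum.inl ()))) ∧
        ∀ j, x (Sum.inr j) < x (Sum.inl (Sum.inl ()))) :=
    ((Sl.coordPos _).and (Sl.all fun j => Sl.coordLt _ _)).and (Sl.all fun j => Sl.coordLt _ _)
  have h := fun (α : S) (i : Fin q) =>
    (Sl.poly' (ι := (Unit ⊕ Fin n2) ⊕ Fin n1) (Sum.inl (Sum.inl ()))
      (Sum.elim (Sum.elim 0 (fun j => Polynomial.C (A1 i (Sum.inl j))))
        (fun j => Polynomial.C (A1 i (Sum.inr j)))) (bb α i)).and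
    (Sl.poly' (ι := (Unit ⊕ Fin n2) ⊕ Fin n1) (Sum.inl (Sum.inl ()))
      (Sum.elim (Sum.elim 0 (fun j => - Polynomial.C (A1 i (Sum.inl j))))
        (fun j => - Polynomial.C (A1 i (Sum.inr j)))) (- bb α i))
  refine (hD.and (Sl.ex fun α => Sl.all fun i => h α i)).congr fun x => ?_
  unfold Qn
  refine and_congr_right fun hx => exists_congr fun α => forall_congr' fun i => ?_
  have hx' : 0 < x (Sum.inl (Sum.inl ())) ∧ ∀ j, x j ≤ x (Sum.inl (Sum.inl ())) := by
    refine ⟨hx.1.1, ?_⟩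
    rintro ((u | j) | j)
    · exact le_rfl
    · exact (hx.1.2 j).le
    · exact (hx.2 j).le
  simp only [hx', true_and, implies_true, and_self, Fintype.sum_sum_type, Sum.elim_inl,
    Sum.elim_inr, Pi.zero_apply, Polynomial.eval_zero, zero_mul, Finset.sum_const_zero, zero_add,
    Polynomial.eval_neg, Polynomial.eval_C, neg_mul, Finset.sum_neg_distrib, evalAt]
  constructor
  · intro h; constructor <;> linarith
  · rintro ⟨h1, h2⟩; linarith

lemma sl_L3n {n1 n2 p q : ℕ} (m : ℕ) {S : Type} [Fintype S]
    (A1 : Matrix (Fin q) (Fin n2 ⊕ Fin n1) ℤ)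
    (bb : S → Fin q → Polynomial ℤ) (A2 : Matrix (Fin p) (Fin n2) (Polynomial ℤ))
    (b2 : Fin p → Polynomial ℤ) : Sl (L3n m A1 bb A2 b2) := by
  have hD : Sl (fun x : Unit ⊕ Fin n2 → ℕ =>
      (0 < x (Sum.inl ()) ∧ ∀ j, x (Sum.inr j) < x (Sum.inl ()))) :=
    ((Sl.coordPos _).and (Sl.all fun j => Sl.coordLt _ _))
  have hc : Sl (fun x : Unit ⊕ Fin n2 → ℕ => m ≤ {z | Qn A1 bb x z}.ncard) :=
    Sl.count m (sl_Qn A1 bb) fun x => (finite_lt (x (Sum.inl ()))).subset fun z hz => hz.1.2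
  have h := fun i : Fin p => Sl.poly' (ι := Unit ⊕ Fin n2) (Sum.inl ())
      (Sum.elim 0 (fun j => A2 i j)) (b2 i)
  refine (hD.and ((Sl.all h).and hc.not)).congr fun x => ?_
  unfold L3n
  refine and_congr_right fun hx => and_congr_left fun _ => forall_congr' fun i => ?_
  have hx' : 0 < x (Sum.inl ()) ∧ ∀ j, x j ≤ x (Sum.inl ()) := by
    refine ⟨hx.1, ?_⟩
    rintro (u | j)
    · exact le_rfl
    · exact (hx.2 j).le
  simp only [hx', true_and, implies_true, and_self, Fintype.sum_sum_type, Sum.elim_inl,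
    Sum.elim_inr, Pi.zero_apply, Polynomial.eval_zero, zero_mul, Finset.sum_const_zero, zero_add,
    evalAt]

/-- The objective value of `y` at parameter `t`. -/
def objn {n2 : ℕ} (c : Fin n2 → Polynomial ℤ) (t : ℕ) (y : Fin n2 → ℕ) : ℤ :=
  ∑ j, evalAt (c j) t * (y j : ℤ)

lemma sl_pair {n2 : ℕ} {P : (Unit ⊕ Fin n2 → ℕ) → Prop} (hP : Sl P)
    (hb : ∀ x, P x → 0 < x (Sum.inl ()) ∧ ∀ j, x (Sum.inr j) < x (Sum.inl ()))
    (c : Fin n2 → Polynomial ℤ) :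
    Sl (fun x : (Unit ⊕ Fin n2) ⊕ Fin n2 → ℕ =>
      P (fun i => x (Sum.inl i)) ∧ P (tv (x (Sum.inl (Sum.inl ()))) (fun k => x (Sum.inr k))) ∧
      objn c (x (Sum.inl (Sum.inl ()))) (fun k => x (Sum.inl (Sum.inr k))) ≤
        objn c (x (Sum.inl (Sum.inl ()))) (fun k => x (Sum.inr k))) ∧
    Sl (fun x : (Unit ⊕ Fin n2) ⊕ Fin n2 → ℕ =>
      P (fun i => x (Sum.inl i)) ∧ P (tv (x (Sum.inl (Sum.inl ()))) (fun k => x (Sum.inr k))) ∧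
      objn c (x (Sum.inl (Sum.inl ()))) (fun k => x (Sum.inl (Sum.inr k))) <
        objn c (x (Sum.inl (Sum.inl ()))) (fun k => x (Sum.inr k))) := by
  have h1 : Sl (fun x : (Unit ⊕ Fin n2) ⊕ Fin n2 → ℕ => P (fun i => x (Sum.inl i))) :=
    hP.comp Sum.inl
  have h2 : Sl (fun x : (Unit ⊕ Fin n2) ⊕ Fin n2 → ℕ =>
      P (tv (x (Sum.inl (Sum.inl ()))) (fun k => x (Sum.inr k)))) := by
    refine (hP.comp (Sum.elim (fun _ => Sum.inl (Sum.inl ())) Sum.inr)).congr fun x => ?_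
    have : tv (x (Sum.inl (Sum.inl ()))) (fun k => x (Sum.inr k)) = fun k =>
        x (Sum.elim (fun _ => Sum.inl (Sum.inl ())) Sum.inr k) := by
      funext k; cases k <;> rfl
    rw [this]
  have h3 := Sl.poly' (ι := (Unit ⊕ Fin n2) ⊕ Fin n2) (Sum.inl (Sum.inl ()))
      (Sum.elim (Sum.elim 0 (fun j => c j)) (fun j => - c j)) 0
  have h4 := (Sl.poly' (ι := (Unit ⊕ Fin n2) ⊕ Fin n2) (Sum.inl (Sum.inl ()))
      (Sum.elim (Sum.elim 0 (fun j => - c j)) (fun j => c j)) 0).not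
  constructor
  · refine (h1.and (h2.and h3)).congr fun x => ?_
    refine and_congr_right fun hx1 => and_congr_right fun hx2 => ?_
    have hx' : 0 < x (Sum.inl (Sum.inl ())) ∧ ∀ j, x j ≤ x (Sum.inl (Sum.inl ())) := by
      refine ⟨(hb _ hx1).1, ?_⟩
      rintro ((u | j) | j)
      · exact le_rfl
      · exact ((hb _ hx1).2 j).le
      · exact ((hb _ hx2).2 j).le
    simp only [hx', true_and, implies_true, and_self, Fintype.sum_sum_type, Sum.elim_inl,
      Sum.elim_inr, Pi.zero_apply, Polynomial.eval_zero, zero_mul, Finset.sum_const_zero, zero_add,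
      Polynomial.eval_neg, neg_mul, Finset.sum_neg_distrib, evalAt, objn]
    constructor <;> intro h <;> linarith
  · refine (h1.and (h2.and h4)).congr fun x => ?_
    refine and_congr_right fun hx1 => and_congr_right fun hx2 => ?_
    have hx' : 0 < x (Sum.inl (Sum.inl ())) ∧ ∀ j, x j ≤ x (Sum.inl (Sum.inl ())) := by
      refine ⟨(hb _ hx1).1, ?_⟩
      rintro ((u | j) | j)
      · exact le_rfl
      · exact ((hb _ hx1).2 j).le
      · exact ((hb _ hx2).2 j).le
    simp only [hx', true_and, implies_true, and_self, Fintype.sum_sum_type, Sum.elim_inl,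
      Sum.elim_inr, Pi.zero_apply, Polynomial.eval_zero, zero_mul, Finset.sum_const_zero, zero_add,
      Polynomial.eval_neg, neg_mul, Finset.sum_neg_distrib, evalAt, objn, not_le]
    constructor <;> intro h <;> linarith

/-- The coordinatewise cast from naturals to integers. -/
def castv {n : ℕ} (y : Fin n → ℕ) : Fin n → ℤ := fun j => (y j : ℤ)

lemma castv_inj {n : ℕ} : Function.Injective (castv (n := n)) := by
  intro x y h
  funext j
  have := congrFun h j
  simpa [castv] using this

lemma exists_castv {n : ℕ} {t : ℕ} (y : Fin n → ℤ) (h : ∀ j, 0 ≤ y j ∧ y j ≤ (t : ℤ) - 1) :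
    ∃ z : Fin n → ℕ, castv z = y ∧ ∀ j, z j < t := by
  refine ⟨fun j => (y j).toNat, ?_, fun j => ?_⟩
  · funext j; simp [castv, (h j).1]
  · have := h j
    change (y j).toNat < t
    omega

lemma latticeL3K_eq {n1 n2 p q : ℕ} (m : ℕ) {S : Type}
    (A1 : Matrix (Fin q) (Fin n2 ⊕ Fin n1) ℤ)
    (bb : S → Fin q → Polynomial ℤ) (A2 : Matrix (Fin p) (Fin n2) (Polynomial ℤ))
    (b2 : Fin p → Polynomial ℤ)
    (hsub : ∀ t : ℕ, 0 < t → ∀ x : Fin n2 → ℝ,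
      (∀ i, ∑ j, (evalAt (A2 i j) t : ℝ) * x j ≤ (evalAt (b2 i) t : ℝ)) →
      ∀ j, 0 ≤ x j ∧ x j ≤ (t : ℝ) - 1) (t : ℕ) (ht : 0 < t) :
    latticeL3K m A1 bb A2 b2 t = castv '' {y | L3n m A1 bb A2 b2 (tv t y)} := by
  have key : ∀ y : Fin n2 → ℕ, (∀ j, y j < t) →
      {y3 : Fin n1 → ℤ | (∀ j, 0 ≤ y3 j ∧ y3 j ≤ (t : ℤ) - 1) ∧
        ∃ α : S, Sum.elim (castv y) y3 ∈ Kset A1 (bb α) t} =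
      castv '' {z | Qn A1 bb (tv t y) z} := by
    intro y hy
    ext y3
    constructor
    · rintro ⟨hb, α, hα⟩
      obtain ⟨z, rfl, hz⟩ := exists_castv y3 hb
      refine ⟨z, ⟨⟨⟨ht, hy⟩, hz⟩, α, fun i => ?_⟩, rfl⟩
      have := hα.2 i
      rw [Fintype.sum_sum_type] at this
      exact this
    · rintro ⟨z, ⟨⟨⟨_, _⟩, hz⟩, α, hα⟩, rfl⟩
      have hzb : ∀ j, 0 ≤ castv z j ∧ castv z j ≤ (t : ℤ) - 1 := fun j => by
        have : z j < t := hz j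
        simp only [castv]; omega
      refine ⟨hzb, α, ?_, fun i => ?_⟩
      · rintro (j | j)
        · have : y j < t := hy j
          simp only [castv, Sum.elim_inl]; omega
        · exact hzb j
      · rw [Fintype.sum_sum_type]
        exact hα i
  ext y2
  constructor
  · rintro ⟨h2, h3⟩
    have hb : ∀ j, 0 ≤ y2 j ∧ y2 j ≤ (t : ℤ) - 1 := by
      intro j
      have := hsub t ht (fun j => (y2 j : ℝ)) (fun i => by exact_mod_cast h2 i) j
      constructor
      · exact_mod_cast this.1
      · exact_mod_cast this.2
    obtain ⟨y, rfl, hy⟩ := exists_castv y2 hb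
    rw [key y hy, Set.ncard_image_of_injective _ castv_inj] at h3
    exact ⟨y, ⟨⟨ht, hy⟩, h2, not_le.2 h3⟩, rfl⟩
  · rintro ⟨y, ⟨⟨_, hy⟩, h2, h3⟩, rfl⟩
    refine ⟨h2, ?_⟩
    rw [key y hy, Set.ncard_image_of_injective _ castv_inj]
    exact not_le.1 h3

/-- exclusion-type problem with constant matrix `A₁` and finitely many
disjoint sets `K(α,t)`: each optimum value function `f_ℓ` is eventually
quasi-polynomial. -/
theorem exclusion_constant_kth_largest_eqp (m n1 n2 p q : ℕ)
    (hm : 0 < m) (hn1 : 0 < n1) (hn2 : 0 < n2) (hp : 0 < p) (hq : 0 < q)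
    (c : Fin n2 → Polynomial ℤ)
    (A1 : Matrix (Fin q) (Fin n2 ⊕ Fin n1) ℤ)
    (A2 : Matrix (Fin p) (Fin n2) (Polynomial ℤ)) (b2 : Fin p → Polynomial ℤ)
    (S : Type) [Fintype S] (bb : S → Fin q → Polynomial ℤ)
    (hsub : ∀ t : ℕ, 0 < t → ∀ x : Fin n2 → ℝ,
      (∀ i, ∑ j, (evalAt (A2 i j) t : ℝ) * x j ≤ (evalAt (b2 i) t : ℝ)) →
      ∀ j, 0 ≤ x j ∧ x j ≤ (t : ℝ) - 1)
    (hdisj : ∀ t : ℕ, 0 < t → ∀ α β : S, α ≠ β →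
      Disjoint (Kset A1 (bb α) t) (Kset A1 (bb β) t))
    (ℓ : ℕ) (hl : 0 < ℓ) (f : ℕ → WithBot ℤ)
    (hf : ∀ t : ℕ, 0 < t → IsKthLargest (latticeL3K m A1 bb A2 b2 t)
      (fun y2 => ∑ j, evalAt (c j) t * y2 j) ℓ (f t)) :
    IsEQPBot f := by
  classical
  set P := L3n m A1 bb A2 b2 with hP
  have hPs : Sl P := sl_L3n m A1 bb A2 b2
  have hb : ∀ x, P x → 0 < x (Sum.inl ()) ∧ ∀ j, x (Sum.inr j) < x (Sum.inl ()) :=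
    fun x hx => hx.1
  obtain ⟨hge, hgt⟩ := sl_pair hPs hb c
  -- the comparison relations
  let Ge : (Unit ⊕ Fin n2 → ℕ) → (Fin n2 → ℕ) → Prop := fun x y =>
    P x ∧ P (tv (x (Sum.inl ())) y) ∧
      objn c (x (Sum.inl ())) (fun k => x (Sum.inr k)) ≤ objn c (x (Sum.inl ())) y
  let Gt : (Unit ⊕ Fin n2 → ℕ) → (Fin n2 → ℕ) → Prop := fun x y =>
    P x ∧ P (tv (x (Sum.inl ())) y) ∧
      objn c (x (Sum.inl ())) (fun k => x (Sum.inr k)) < objn c (x (Sum.inl ())) y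
  have hGe : Sl (fun x => ℓ ≤ {y | Ge x y}.ncard) :=
    Sl.count ℓ hge fun x => (finite_lt (x (Sum.inl ()))).subset fun y hy => (hb _ hy.2.1).2
  have hGt : Sl (fun x => ℓ ≤ {y | Gt x y}.ncard) :=
    Sl.count ℓ hgt fun x => (finite_lt (x (Sum.inl ()))).subset fun y hy => (hb _ hy.2.1).2
  have hM := hPs.and (hGt.not.and hGe)
  have hxtv : ∀ x : Unit ⊕ Fin n2 → ℕ, tv (x (Sum.inl ())) (fun k => x (Sum.inr k)) = x := by
    intro x; funext k; cases k <;> rfl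
  -- transfer of the counts
  have hkth : ∀ t : ℕ, 0 < t → IsKthLargest {y | P (tv t y)} (objn c t) ℓ (f t) := by
    intro t ht
    have h := hf t ht
    rw [latticeL3K_eq m A1 bb A2 b2 hsub t ht] at h
    have hsep : ∀ Q : (Fin n2 → ℤ) → Prop,
        {x ∈ castv '' {y | P (tv t y)} | Q x}.ncard = {y ∈ {y | P (tv t y)} | Q (castv y)}.ncard := by
      intro Q
      rw [← Set.ncard_image_of_injective _ castv_inj]
      congr 1
      ext x
      constructor
      · rintro ⟨⟨y, hy, rfl⟩, hQ⟩; exact ⟨y, ⟨hy, hQ⟩, rfl⟩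
      · rintro ⟨y, ⟨hy, hQ⟩, rfl⟩; exact ⟨⟨y, hy, rfl⟩, hQ⟩
    unfold IsKthLargest at h
    simp only [← hP] at h
    rw [Set.ncard_image_of_injective _ castv_inj] at h
    rcases h with h | ⟨h1, z, hz, h2, h3⟩
    · exact Or.inl h
    · rw [hsep] at h2 h3
      exact Or.inr ⟨h1, z, hz, h2, h3⟩
  have hfin : ∀ t : ℕ, {y | P (tv t y)}.Finite := fun t =>
    (finite_lt t).subset fun y hy => (hb _ hy).2
  refine eqp_of_semilinear c _ hM f ?_ ?_
  · intro t ht hne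
    obtain ⟨y, hy, h1, h2⟩ := (kth_char _ (hfin t) _ _ _ (hkth t ht)).1 hne
    have hy' : P (tv t y) := hy
    refine ⟨tv t y, ⟨hy', ?_, ?_⟩, rfl⟩
    · rw [not_le]
      refine lt_of_eq_of_lt (congrArg Set.ncard ?_) h1
      ext y'
      exact ⟨fun h => h.2, fun h => ⟨hy', h⟩⟩
    · refine le_of_le_of_eq h2 (congrArg Set.ncard ?_)
      ext y'
      exact ⟨fun h => ⟨hy', h⟩, fun h => h.2⟩
  · rintro x ⟨hx, h1, h2⟩
    have ht := (hb x hx).1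
    refine (kth_char _ (hfin _) _ _ _ (hkth _ ht)).2 (fun k => x (Sum.inr k)) ?_ ?_ ?_
    · change P _
      rw [hxtv]; exact hx
    · rw [not_le] at h1
      refine lt_of_eq_of_lt (congrArg Set.ncard ?_) h1
      ext y'
      exact ⟨fun h => ⟨hx, h⟩, fun h => h.2⟩
    · refine le_of_le_of_eq h2 (congrArg Set.ncard ?_)
      ext y'
      exact ⟨fun h => h.2, fun h => ⟨hx, h⟩⟩
end

section
/- Let m, n_1, n_2, p, q be positive integers, A_1 a q × (n_1+n_2) matrix with constant integer entries, A_2 a p × n_2 matrix of polynomials with integer coefficients, b_2 a vector of p such polynomials, 𝔖 a finite set, and for each α ∈ 𝔖 let b(α) be a vector of q polynomials with integer coefficients. For each positive integer t let R_2(t) = {y₂ ∈ ℝ^{n_2} : A_2(t)y₂ ≤ b_2(t)} and, for each α ∈ 𝔖, K(α,t) = {y ∈ {0, …, t−1}^{n_1+n_2} : A_1 y = b(α)(t)}. Assume that for every t, R_2(t) ⊆ [0, t−1]^{n_2} and the sets K(α,t), α ∈ 𝔖, are pairwise disjoint. Let L_2(t) = R_2(t) ∩ ℤ^{n_2} and L_3(t)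 = {y₂ ∈ L_2(t) : the number of y₃ ∈ {0, …, t−1}^{n_1} with (y₂, y₃) ∈ ⋃_{α ∈ 𝔖} K(α,t) is less than m}, where (y₂, y₃) is the concatenated vector with y₂ in the first n_2 coordinates. Then the size function g(t) = |L_3(t)| is eventually quasi-polynomial. -/
/-- A function `f` (on sufficiently large positive integers) is eventually
quasi-polynomial if there are a period `d > 0` and rational polynomials `R₀, …, R_{d-1}`
with `f t = R_{t mod d}(t)` for all sufficiently large `t`. -/
def IsEQP (f : ℕ → ℤ) : Prop :=
  ∃ d : ℕ, 0 < d ∧ ∃ R : ℕ → Polynomial ℚ, ∃ N : ℕ,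
    ∀ t : ℕ, N ≤ t → (f t : ℚ) = (R (t % d)).eval (t : ℚ)

namespace ECS
open Polynomial

/-- The shift operator on rational sequences. -/
noncomputable def shiftOp : Module.End ℚ (ℕ → ℚ) := LinearMap.funLeft ℚ ℚ (fun t : ℕ => t + 1)

lemma shiftOp_pow (n : ℕ) (f : ℕ → ℚ) (t : ℕ) : (shiftOp ^ n) f t = f (t + n) := by
  induction n generalizing t with
  | zero => simp
  | succ n ih =>
    rw [pow_succ', Module.End.mul_apply]
    change (shiftOp ^ n) f (t + 1) = _
    rw [ih]; congr 1; omega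

/-- Sequences annihilated by some `E^m (E^d - 1)^k`. -/
def Good (f : ℕ → ℚ) : Prop :=
  ∃ m d k : ℕ, 0 < d ∧ aeval shiftOp ((X : ℚ[X]) ^ m * (X ^ d - 1) ^ k) f = 0

lemma aeval_of_dvd {p q : ℚ[X]} (h : p ∣ q) {f : ℕ → ℚ} (hf : aeval shiftOp p f = 0) :
    aeval shiftOp q f = 0 := by
  obtain ⟨r, rfl⟩ := h
  rw [mul_comm, map_mul, Module.End.mul_apply, hf, map_zero]

lemma dvd_aux (m₁ m₂ d₁ d₂ k₁ k₂ : ℕ) (hm : m₁ ≤ m₂) (hd : d₁ ∣ d₂) (hk : k₁ ≤ k₂) :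
    (X : ℚ[X]) ^ m₁ * (X ^ d₁ - 1) ^ k₁ ∣ (X : ℚ[X]) ^ m₂ * (X ^ d₂ - 1) ^ k₂ := by
  refine mul_dvd_mul (pow_dvd_pow _ hm) ?_
  refine (pow_dvd_pow_of_dvd ?_ k₁).trans (pow_dvd_pow _ hk)
  obtain ⟨c, rfl⟩ := hd
  rw [pow_mul]
  simpa using sub_dvd_pow_sub_pow ((X : ℚ[X]) ^ d₁) 1 c

lemma Good.add {f g : ℕ → ℚ} (hf : Good f) (hg : Good g) : Good (fun t => f t + g t) := by
  obtain ⟨m₁, d₁, k₁, h₁, hf⟩ := hf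
  obtain ⟨m₂, d₂, k₂, h₂, hg⟩ := hg
  refine ⟨max m₁ m₂, d₁ * d₂, max k₁ k₂, by positivity, ?_⟩
  change aeval shiftOp _ (f + g) = 0
  rw [map_add, aeval_of_dvd (dvd_aux _ _ _ _ _ _ (le_max_left _ _) (dvd_mul_right _ _)
    (le_max_left _ _)) hf, aeval_of_dvd (dvd_aux _ _ _ _ _ _ (le_max_right _ _) (dvd_mul_left _ _)
    (le_max_right _ _)) hg, add_zero]

lemma Good.neg {f : ℕ → ℚ} (hf : Good f) : Good (fun t => - f t) := by
  obtain ⟨m₁, d₁, k₁, h₁, hf⟩ := hf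
  refine ⟨m₁, d₁, k₁, h₁, ?_⟩
  change aeval shiftOp _ (-f) = 0
  rw [map_neg, hf, neg_zero]

lemma Good.sub {f g : ℕ → ℚ} (hf : Good f) (hg : Good g) : Good (fun t => f t - g t) := by
  simpa [sub_eq_add_neg] using hf.add hg.neg

lemma good_zero : Good (fun _ => 0) := ⟨0, 1, 0, one_pos, by
  change aeval shiftOp _ (0 : ℕ → ℚ) = 0
  rw [map_zero]⟩

lemma good_sum {ι : Type*} (s : Finset ι) (f : ι → ℕ → ℚ) (h : ∀ i ∈ s, Good (f i)) :
    Good (fun t => ∑ i ∈ s, f i t) := by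
  classical
  induction s using Finset.induction_on with
  | empty => simpa using good_zero
  | insert a s ha ih =>
    simp only [Finset.sum_insert ha]
    exact (h a (by simp)).add (ih fun i hi => h i (by simp [hi]))

lemma Good.of_shift {f : ℕ → ℚ} (c : ℕ) (hf : Good (fun t => f (t + c))) : Good f := by
  obtain ⟨m, d, k, hd, h⟩ := hf
  refine ⟨m + c, d, k, hd, ?_⟩
  have : (fun t => f (t + c)) = aeval shiftOp ((X : ℚ[X]) ^ c) f := by
    ext t; simp [shiftOp_pow]
  rw [this, ← Module.End.mul_apply, ← map_mul] at h
  rw [← h]; congr 2; ring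

lemma Good.shift {f : ℕ → ℚ} (c : ℕ) (hf : Good f) : Good (fun t => f (t + c)) := by
  obtain ⟨m, d, k, hd, h⟩ := hf
  refine ⟨m, d, k, hd, ?_⟩
  have : (fun t => f (t + c)) = aeval shiftOp ((X : ℚ[X]) ^ c) f := by
    ext t; simp [shiftOp_pow]
  rw [this, ← Module.End.mul_apply, ← map_mul]
  exact aeval_of_dvd (dvd_mul_right _ _) h

lemma Good.antidiff {g : ℕ → ℚ} (w : ℕ) (hw : 0 < w) (h : Good (fun t => g (t + w) - g t)) :
    Good g := by
  obtain ⟨m, d, k, hd, h⟩ := h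
  refine ⟨m, d * w, k + 1, by positivity, ?_⟩
  have : (fun t => g (t + w) - g t) = aeval shiftOp ((X : ℚ[X]) ^ w - 1) g := by
    ext t; simp [shiftOp_pow]
  rw [this, ← Module.End.mul_apply, ← map_mul] at h
  refine aeval_of_dvd ?_ h
  rw [pow_succ, ← mul_assoc]
  refine mul_dvd_mul (dvd_aux _ _ _ _ _ _ le_rfl (dvd_mul_right _ _) le_rfl) ?_
  simpa using dvd_aux 0 0 w (d * w) 1 1 le_rfl (dvd_mul_left _ _) le_rfl

lemma poly_of_fwdDiff (k : ℕ) (G : ℕ → ℚ) (h : ∀ n, (fwdDiff 1)^[k] G n = 0) :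
    ∃ P : ℚ[X], ∀ n : ℕ, G n = P.eval (n : ℚ) := by
  have hz : ∀ j, k ≤ j → (fwdDiff 1)^[j] G 0 = 0 := by
    intro j hj
    obtain ⟨i, rfl⟩ := Nat.exists_eq_add_of_le' hj
    rw [Function.iterate_add_apply]
    have : (fwdDiff 1)^[k] G = 0 := funext h
    rw [this]
    clear hj
    induction i with
    | zero => rfl
    | succ i ih =>
      rw [Function.iterate_succ_apply]
      have : fwdDiff 1 (0 : ℕ → ℚ) = 0 := by ext; simp [fwdDiff]
      rw [this, ih]
  refine ⟨∑ j ∈ Finset.range k, C ((fwdDiff 1)^[j] G 0 / j.factorial) * descPochhammer ℚ j, ?_⟩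
  intro n
  have := shift_eq_sum_fwdDiff_iter (1 : ℕ) G n 0
  simp only [smul_eq_mul, mul_one, zero_add] at this
  rw [this, eval_finsetSum]
  have e1 : ∑ j ∈ Finset.range (n + 1), n.choose j • (fwdDiff 1)^[j] G 0
      = ∑ j ∈ Finset.range (n + 1 + k), n.choose j • (fwdDiff 1)^[j] G 0 := by
    refine Finset.sum_subset (by intro x; simp; omega) ?_
    intro x _ hx
    rw [Nat.choose_eq_zero_of_lt (by simp at hx; omega), zero_smul]
  have e2 : ∑ j ∈ Finset.range k, n.choose j • (fwdDiff 1)^[j] G 0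
      = ∑ j ∈ Finset.range (n + 1 + k), n.choose j • (fwdDiff 1)^[j] G 0 := by
    refine Finset.sum_subset (by intro x; simp; omega) ?_
    intro x _ hx
    rw [hz _ (by simpa using hx), smul_zero]
  rw [e1, ← e2]
  refine Finset.sum_congr rfl fun j _ => ?_
  rw [eval_mul, eval_C, descPochhammer_eval_eq_descFactorial, Nat.descFactorial_eq_factorial_mul_choose]
  have := Nat.factorial_ne_zero j
  push_cast
  field_simp
  simp [mul_comm]

lemma iter_sub (d j : ℕ) (h : ℕ → ℚ) (a n : ℕ) :
    (fwdDiff 1)^[j] (fun n => h (a + d * n)) n = (((shiftOp ^ d - 1) ^ j) h) (a + d * n) := by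
  induction j generalizing n with
  | zero => simp
  | succ j ih =>
    rw [Function.iterate_succ_apply', fwdDiff, ih, ih, pow_succ', Module.End.mul_apply]
    rw [LinearMap.sub_apply, Pi.sub_apply, shiftOp_pow]
    simp [mul_add, add_assoc]

lemma Good.isEQP {f : ℕ → ℤ} (h : Good (fun t => (f t : ℚ))) : IsEQP f := by
  obtain ⟨m, d, k, hd, h⟩ := h
  set F : ℕ → ℚ := fun t => (f t : ℚ) with hF
  have key : ∀ r : ℕ, ∃ P : ℚ[X], ∀ n : ℕ, F (m * d + r + d * n) = P.eval (n : ℚ) := by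
    intro r
    apply poly_of_fwdDiff k
    intro n
    rw [iter_sub]
    have hmd : m ≤ m * d := Nat.le_mul_of_pos_right _ hd
    have := congrFun h (m * d - m + r + d * n)
    rw [map_mul, Module.End.mul_apply] at this
    simp only [map_pow, aeval_X, map_sub, map_one, shiftOp_pow, Pi.zero_apply] at this
    have e : m * d + r + d * n = m * d - m + r + d * n + m := by omega
    rw [e]; exact this
  choose P hP using key
  refine ⟨d, hd, fun r => (P r).comp (C (1 / (d : ℚ)) * (X - C ((m * d + r : ℕ) : ℚ))), m * d + d, ?_⟩
  intro t ht
  have hr := Nat.mod_lt t hd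
  have e := Nat.div_add_mod t d
  have hle : m ≤ t / d := by
    rw [Nat.le_div_iff_mul_le hd]; omega
  obtain ⟨n, hn⟩ := Nat.exists_eq_add_of_le hle
  have ht' : t = m * d + t % d + d * n := by
    conv_lhs => rw [← e, hn]
    ring
  have := hP (t % d) n
  rw [← ht'] at this
  change F t = _
  rw [this, eval_comp]
  congr 1
  simp only [eval_mul, eval_C, eval_sub, eval_X]
  have hd' : (d : ℚ) ≠ 0 := by positivity
  have : (t : ℚ) = ((m * d + t % d : ℕ) : ℚ) + d * n := by exact_mod_cast ht'
  rw [this]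
  field_simp
  ring
end ECS

namespace ECS
open Polynomial

/-- Fibre count. -/
noncomputable def cnt {α : Type*} (τ : α → ℕ) (X : Set α) (t : ℕ) : ℚ :=
  ((X ∩ {x | τ x = t}).ncard : ℚ)

/-- Finite fibres. -/
def FF {α : Type*} (τ : α → ℕ) (X : Set α) : Prop := ∀ t, (X ∩ {x | τ x = t}).Finite

lemma FF.mono {α : Type*} {τ : α → ℕ} {X Y : Set α} (h : FF τ Y) (hXY : X ⊆ Y) : FF τ X :=
  fun t => (h t).subset (Set.inter_subset_inter_left _ hXY)

lemma FF.union {α : Type*} {τ : α → ℕ} {X Y : Set α} (h : FF τ X) (h' : FF τ Y) :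
    FF τ (X ∪ Y) := fun t => by
  rw [Set.union_inter_distrib_right]; exact (h t).union (h' t)

lemma cnt_union {α : Type*} {τ : α → ℕ} {X Y : Set α} (h : FF τ X) (h' : FF τ Y) (t : ℕ) :
    cnt τ (X ∪ Y) t = cnt τ X t + cnt τ Y t - cnt τ (X ∩ Y) t := by
  have := Set.ncard_union_add_ncard_inter _ _ (h t) (h' t)
  unfold cnt
  rw [Set.union_inter_distrib_right, Set.inter_inter_distrib_right, eq_sub_iff_add_eq]
  exact_mod_cast this

lemma good_union {α : Type*} {τ : α → ℕ} {X Y : Set α} (h : FF τ X) (h' : FF τ Y)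
    (gX : Good (cnt τ X)) (gY : Good (cnt τ Y)) (gXY : Good (cnt τ (X ∩ Y))) :
    Good (cnt τ (X ∪ Y)) := by
  have : cnt τ (X ∪ Y) = fun t => cnt τ X t + cnt τ Y t - cnt τ (X ∩ Y) t :=
    funext (cnt_union h h')
  rw [this]
  exact (gX.add gY).sub gXY

lemma cnt_empty {α : Type*} (τ : α → ℕ) : cnt τ ∅ = fun _ => 0 := by
  ext t; simp [cnt]

/-- Unions of members of an intersection-closed class. -/
lemma good_sUnion {α : Type*} {τ : α → ℕ} (C : Set (Set α))
    (hC : ∀ X ∈ C, ∀ Y ∈ C, X ∩ Y ∈ C) (hF : ∀ X ∈ C, FF τ X) (hG : ∀ X ∈ C, Good (cnt τ X))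
    (S : Set (Set α)) (hS : S.Finite) (hSC : S ⊆ C) :
    FF τ (⋃₀ S) ∧ Good (cnt τ (⋃₀ S)) ∧ ∀ Y ∈ C, Good (cnt τ (Y ∩ ⋃₀ S)) := by
  induction S, hS using Set.Finite.induction_on with
  | empty =>
    simp only [Set.sUnion_empty, Set.inter_empty, cnt_empty]
    exact ⟨fun t => by simp, good_zero, fun _ _ => good_zero⟩
  | @insert X S _ _ ih =>
    have hX : X ∈ C := hSC (Set.mem_insert _ _)
    obtain ⟨h1, h2, h3⟩ := ih ((Set.subset_insert _ _).trans hSC)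
    rw [Set.sUnion_insert]
    refine ⟨(hF X hX).union h1, good_union (hF X hX) h1 (hG X hX) h2 (h3 X hX), ?_⟩
    intro Y hY
    rw [Set.inter_union_distrib_left]
    refine good_union (hF _ (hC _ hY _ hX)) (h1.mono Set.inter_subset_right) (hG _ (hC _ hY _ hX))
      (h3 Y hY) ?_
    have : Y ∩ X ∩ (Y ∩ ⋃₀ S) = (Y ∩ X) ∩ ⋃₀ S := by
      ext; simp; tauto
    rw [this]
    exact h3 _ (hC _ hY _ hX)

section NatPow
variable {κ : Type*} [Fintype κ] (w : κ → ℕ)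

/-- Weight of an exponent vector. -/
def wt (u : κ → ℕ) : ℕ := ∑ j, w j * u j

lemma wt_add (u v : κ → ℕ) : wt w (u + v) = wt w u + wt w v := by
  simp [wt, mul_add, Finset.sum_add_distrib]

lemma ff_wt (hw : ∀ j, 0 < w j) (X : Set (κ → ℕ)) : FF (wt w) X := by
  classical
  intro t
  refine (Set.finite_Iic (fun _ : κ => t)).subset ?_
  rintro u ⟨_, hu⟩ j
  have h1 : w j * u j ≤ wt w u :=
    Finset.single_le_sum (f := fun j => w j * u j) (fun _ _ => Nat.zero_le _) (Finset.mem_univ j)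
  have h2 : u j ≤ w j * u j := Nat.le_mul_of_pos_left _ (hw j)
  have h3 : wt w u = t := hu
  change u j ≤ t
  omega

lemma good_supp (hw : ∀ j, 0 < w j) (A : Finset κ) :
    Good (cnt (wt w) {u | ∀ j ∉ A, u j = 0}) := by
  classical
  induction A using Finset.induction_on with
  | empty =>
    refine Good.of_shift 1 ?_
    have : (fun t => cnt (wt w) {u | ∀ j ∉ (∅ : Finset κ), u j = 0} (t + 1)) = fun _ => 0 := by
      ext t
      have : {u : κ → ℕ | ∀ j ∉ (∅ : Finset κ), u j = 0} ∩ {x | wt w x = t + 1} = ∅ := by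
        ext u
        simp only [Finset.notMem_empty, not_false_eq_true, forall_const, Set.mem_inter_iff,
          Set.mem_ofPred_eq, Set.mem_empty_iff_false, iff_false, not_and]
        intro h
        simp [wt, h]
      rw [cnt, this]; simp
    rw [this]; exact good_zero
  | insert a A ha ih =>
    refine Good.antidiff (w a) (hw a) ?_
    have key : ∀ t, cnt (wt w) {u | ∀ j ∉ insert a A, u j = 0} (t + w a)
        - cnt (wt w) {u | ∀ j ∉ insert a A, u j = 0} t
        = cnt (wt w) {u | ∀ j ∉ A, u j = 0} (t + w a) := by
      intro t
      set e : κ → ℕ := Pi.single a 1 with he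
      have hwe : wt w e = w a := by
        simp [wt, he, Pi.single_apply]
      have hinj : Function.Injective (fun u : κ → ℕ => u + e) := add_left_injective e
      have hset : {u : κ → ℕ | ∀ j ∉ insert a A, u j = 0} ∩ {x | wt w x = t + w a}
          = ({u | ∀ j ∉ A, u j = 0} ∩ {x | wt w x = t + w a}) ∪
            (fun u : κ → ℕ => u + e) '' ({u | ∀ j ∉ insert a A, u j = 0} ∩ {x | wt w x = t}) := by
        ext u
        constructor
        · rintro ⟨h1, h2⟩
          by_cases h0 : u a = 0
          · left
            refine ⟨fun j hj => ?_, h2⟩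
            by_cases hja : j = a
            · rw [hja, h0]
            · exact h1 j (by simp [hja, hj])
          · right
            have hle : e ≤ u := by
              intro j
              by_cases hja : j = a
              · subst hja; simp [he]; omega
              · simp [he, hja]
            have hue : u - e + e = u := tsub_add_cancel_of_le hle
            refine ⟨u - e, ⟨fun j hj => ?_, ?_⟩, hue⟩
            · simp [h1 j hj]
            · have h3 : wt w u = t + w a := h2
              rw [← hue, wt_add, hwe] at h3
              change wt w (u - e) = t
              omega
        · rintro (⟨h1, h2⟩ | ⟨v, ⟨h1, h2⟩, rfl⟩)
          · exact ⟨fun j hj => h1 j (by simp at hj; tauto), h2⟩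
          · refine ⟨fun j hj => ?_, ?_⟩
            · have := h1 j hj
              have hja : j ≠ a := by rintro rfl; simp at hj
              simp [this, he, hja]
            · have h3 : wt w v = t := h2
              change wt w (v + e) = _
              rw [wt_add, hwe, h3]
      have hdisj : Disjoint ({u : κ → ℕ | ∀ j ∉ A, u j = 0} ∩ {x | wt w x = t + w a})
            ((fun u : κ → ℕ => u + e) '' ({u | ∀ j ∉ insert a A, u j = 0} ∩ {x | wt w x = t})) := by
        rw [Set.disjoint_left]
        rintro _ ⟨h1, _⟩ ⟨v, _, rfl⟩
        have := h1 a ha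
        simp [he] at this
      have hc := Set.ncard_union_eq hdisj (ff_wt w hw _ _) ((ff_wt w hw _ _).image _)
      rw [← hset, Set.ncard_image_of_injective _ hinj] at hc
      unfold cnt
      rw [hc]; push_cast; ring
    simp only [key]
    exact ih.shift (w a)

lemma good_univ (hw : ∀ j, 0 < w j) : Good (cnt (wt w) Set.univ) := by
  have := good_supp w hw Finset.univ
  simpa using this

lemma good_Ici (hw : ∀ j, 0 < w j) (v : κ → ℕ) : Good (cnt (wt w) (Set.Ici v)) := by
  refine Good.of_shift (wt w v) ?_
  have : (fun t => cnt (wt w) (Set.Ici v) (t + wt w v)) = cnt (wt w) Set.univ := by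
    ext t
    unfold cnt
    rw [← Set.ncard_image_of_injective (Set.univ ∩ {x | wt w x = t}) (add_left_injective v)]
    congr 2
    ext u
    constructor
    · rintro ⟨h1, h2⟩
      have hue : u - v + v = u := tsub_add_cancel_of_le h1
      refine ⟨u - v, ⟨trivial, ?_⟩, hue⟩
      have h3 : wt w u = t + wt w v := h2
      rw [← hue, wt_add] at h3
      change wt w (u - v) = t
      omega
    · rintro ⟨z, ⟨_, h2⟩, rfl⟩
      have h3 : wt w z = t := h2
      refine ⟨(le_add_self : v ≤ z + v), ?_⟩
      change wt w (z + v) = _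
      rw [wt_add, h3]
  rw [this]
  exact good_univ w hw

lemma good_upper (hw : ∀ j, 0 < w j) (U : Set (κ → ℕ)) (hU : IsUpperSet U) :
    Good (cnt (wt w) U) := by
  have hfin : {x | Minimal (· ∈ U) x}.Finite :=
    WellQuasiOrderedLE.finite_of_isAntichain (setOfPred_minimal_antichain _)
  have hUeq : U = ⋃₀ (Set.Ici '' {x | Minimal (· ∈ U) x}) := by
    ext u
    constructor
    · intro hu
      obtain ⟨m, hm, hm'⟩ := exists_minimal_le_of_wellFoundedLT (· ∈ U) u hu
      exact ⟨_, ⟨m, hm', rfl⟩, hm⟩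
    · rintro ⟨_, ⟨m, hm, rfl⟩, h⟩
      exact hU h hm.1
  rw [hUeq]
  refine (good_sUnion (Set.range Set.Ici) ?_ (fun X _ => ff_wt w hw X) ?_ _ (hfin.image _) ?_).2.1
  · rintro _ ⟨a, rfl⟩ _ ⟨b, rfl⟩
    exact ⟨a ⊔ b, Set.Ici_inter_Ici.symm⟩
  · rintro _ ⟨a, rfl⟩
    exact good_Ici w hw a
  · rintro _ ⟨a, _, rfl⟩
    exact ⟨a, rfl⟩

lemma good_lower (hw : ∀ j, 0 < w j) (D : Set (κ → ℕ)) (hD : IsLowerSet D) :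
    Good (cnt (wt w) D) := by
  have : cnt (wt w) D = fun t => cnt (wt w) Set.univ t - cnt (wt w) Dᶜ t := by
    ext t
    have := cnt_union (ff_wt w hw D) (ff_wt w hw Dᶜ) t
    rw [Set.union_compl_self, Set.inter_compl_self, cnt_empty] at this
    rw [this]; ring
  rw [this]
  exact (good_univ w hw).sub (good_upper w hw _ hD.compl)
end NatPow
end ECS

namespace ECS
open Polynomial

section Count
variable {M : Type*} [AddCommMonoid M] (τ : M →+ ℕ)

/-- The value `f + ∑ u_j h_j`. -/
def val {κ : Type*} [Fintype κ] (h : κ → M) (u : κ → ℕ) : M := ∑ j, u j • h j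

lemma val_add {κ : Type*} [Fintype κ] (h : κ → M) (u v : κ → ℕ) :
    val h (u + v) = val h u + val h v := by
  simp [val, add_smul, Finset.sum_add_distrib]

lemma tau_val {κ : Type*} [Fintype κ] (h : κ → M) (u : κ → ℕ) :
    τ (val h u) = wt (fun j => τ (h j)) u := by
  simp [val, wt, map_sum, mul_comm]

lemma good_module {κ : Type} [Fintype κ] [LinearOrder κ] (h : κ → M) (hw : ∀ j, 0 < τ (h j))
    (r : ℕ) (f : Fin r → M) :
    Good (cnt τ {x | ∃ i u, x = f i + val h u}) := by
  classical
  set w : κ → ℕ := fun j => τ (h j) with hwdef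
  let key (i : Fin r) (u : κ → ℕ) : Fin r ×ₗ Lex (κ → ℕ) := toLex (i, toLex u)
  let D (i : Fin r) : Set (κ → ℕ) :=
    {u | ∀ i' u', f i' + val h u' = f i + val h u → key i u ≤ key i' u'}
  have hD : ∀ i, IsLowerSet (D i) := by
    intro i u v hvu hu i' u' heq
    obtain ⟨z, rfl⟩ := exists_add_of_le hvu
    have := hu i' (u' + z) (by rw [val_add, val_add, ← add_assoc, ← add_assoc, heq])
    simp only [key, Prod.Lex.toLex_le_toLex] at this ⊢
    rcases this with h1 | ⟨h1, h2⟩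
    · exact Or.inl h1
    · refine Or.inr ⟨h1, ?_⟩
      rw [toLex_add, toLex_add] at h2
      exact le_of_add_le_add_right h2
  let E (i : Fin r) (t : ℕ) : Set (κ → ℕ) := D i ∩ {u | τ (f i) + wt w u = t}
  have hEfin : ∀ i t, (E i t).Finite := by
    intro i t
    refine (ff_wt w hw (D i) (t - τ (f i))).subset ?_
    rintro u ⟨h1, h2⟩
    have h3 : τ (f i) + wt w u = t := h2
    refine ⟨h1, ?_⟩
    change wt w u = _
    omega
  have hEgood : ∀ i, Good (fun t => ((E i t).ncard : ℚ)) := by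
    intro i
    refine Good.of_shift (τ (f i)) ?_
    have : (fun t => ((E i (t + τ (f i))).ncard : ℚ)) = cnt (wt w) (D i) := by
      ext t
      unfold cnt
      congr 2
      ext u
      refine and_congr_right fun _ => ?_
      change τ (f i) + wt w u = t + τ (f i) ↔ wt w u = t
      omega
    rw [this]
    exact good_lower w hw _ (hD i)
  have hcount : ∀ t, cnt τ {x | ∃ i u, x = f i + val h u} t = ∑ i, ((E i t).ncard : ℚ) := by
    intro t
    unfold cnt
    have hfin : ∀ i, Finite (E i t) := fun i => hEfin i t
    rw [← Nat.cast_sum]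
    congr 1
    have e := Nat.card_sigma (β := fun i => E i t)
    simp only [Nat.card_coe_set_eq] at e
    rw [← e, ← Nat.card_coe_set_eq]
    symm
    have hmem : ∀ p : (Σ i, E i t), f p.1 + val h p.2.1 ∈
        ({x | ∃ i u, x = f i + val h u} ∩ {x | τ x = t} : Set M) := by
      rintro ⟨i, u, hu1, hu2⟩
      refine ⟨⟨i, u, rfl⟩, ?_⟩
      change τ (f i + val h u) = t
      rw [map_add, tau_val]
      exact hu2
    refine Nat.card_eq_of_bijective (fun p => ⟨f p.1 + val h p.2.1, hmem p⟩) ⟨?_, ?_⟩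
    · rintro ⟨i, u, hu1, hu2⟩ ⟨i', u', hu1', hu2'⟩ heq
      simp only [Subtype.mk.injEq] at heq
      have := le_antisymm (hu1 i' u' heq.symm) (hu1' i u heq)
      simp only [key] at this
      have h2 := toLex.injective this
      rw [Prod.mk.injEq] at h2
      obtain ⟨rfl, h3⟩ := h2
      have h4 := toLex.injective h3
      subst h4
      rfl
    · rintro ⟨x, ⟨i, u, rfl⟩, hx⟩
      have hne : {k : Fin r ×ₗ Lex (κ → ℕ) |
          f (ofLex k).1 + val h (ofLex (ofLex k).2) = f i + val h u}.Nonempty :=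
        ⟨key i u, rfl⟩
      have hwf : WellFounded (fun a b : Fin r ×ₗ Lex (κ → ℕ) => a < b) := wellFounded_lt
      obtain ⟨k, hk, hmin⟩ := hwf.has_min _ hne
      have hk' : f (ofLex k).1 + val h (ofLex (ofLex k).2) = f i + val h u := hk
      refine ⟨⟨(ofLex k).1, ofLex (ofLex k).2, ?_, ?_⟩, ?_⟩
      · intro i' u' h'
        exact not_lt.1 (hmin (key i' u') (h'.trans hk'))
      · change τ (f _) + wt w _ = t
        rw [← tau_val, ← map_add, hk']
        exact hx
      · exact Subtype.ext hk'
  have : cnt τ {x | ∃ i u, x = f i + val h u} = fun t => ∑ i, ((E i t).ncard : ℚ) := funext hcount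
  rw [this]
  exact good_sum _ _ fun i _ => hEgood i

/-- Sets of the form `F + N` with `F` finite and `N` a finitely generated submonoid. -/
def FinMod (X : Set M) : Prop :=
  ∃ (F : Set M) (N : AddSubmonoid M), F.Finite ∧ N.FG ∧ X = {x | ∃ a ∈ F, ∃ n ∈ N, x = a + n}

end Count

section NatVec
variable {ι : Type} (τ : (ι → ℕ) →+ ℕ)

lemma good_finMod (X : Set (ι → ℕ)) (hX : FinMod X) (hFF : FF τ X) : Good (cnt τ X) := by
  classical
  obtain ⟨F, N, hF, hN, rfl⟩ := hX
  obtain ⟨l, φ, rfl⟩ := AddSubmonoid.fg_iff_exists_fin_addMonoidHom.1 hN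
  rcases F.eq_empty_or_nonempty with rfl | ⟨a₀, ha₀⟩
  · simp only [Set.mem_empty_iff_false, false_and, exists_false, Set.ofPred_false]
    rw [cnt_empty]; exact good_zero
  have : Finite F := hF
  obtain ⟨r, ⟨e⟩⟩ := Finite.exists_equiv_fin F
  let g : Fin l → (ι → ℕ) := fun j => φ (Pi.single j 1)
  have hφ : ∀ u, φ u = ∑ j, u j • g j := by
    intro u
    conv_lhs => rw [← Finset.univ_sum_single u, map_sum]
    refine Finset.sum_congr rfl fun j _ => ?_
    rw [← map_nsmul]; congr 1
    ext i; by_cases hi : i = j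
    · subst hi; simp
    · simp [hi]
  have hpos : ∀ j : {j : Fin l // g j ≠ 0}, 0 < τ (g j.1) := by
    rintro ⟨j, hj⟩
    by_contra h0
    have h0 : τ (g j) = 0 := by simpa using h0
    refine Set.infinite_of_injective_forall_mem (f := fun n : ℕ => a₀ + n • g j) ?_ ?_
      (hFF (τ a₀))
    · intro m n hmn
      have hmn : m • g j = n • g j := add_left_cancel hmn
      obtain ⟨i, hi⟩ := Function.ne_iff.1 hj
      have := congrFun hmn i
      simp only [Pi.smul_apply, smul_eq_mul] at this
      exact Nat.eq_of_mul_eq_mul_right (Nat.pos_of_ne_zero hi) this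
    · intro n
      refine ⟨⟨a₀, ha₀, n • g j, ⟨n • Pi.single j 1, map_nsmul φ n _⟩, rfl⟩, ?_⟩
      change τ (a₀ + n • g j) = τ a₀
      rw [map_add, map_nsmul, h0]; simp
  have := good_module τ (fun j : {j : Fin l // g j ≠ 0} => g j.1) hpos r (fun i => (e.symm i).1)
  convert! this using 2
  ext x
  constructor
  · rintro ⟨a, ha, _, ⟨u, rfl⟩, rfl⟩
    refine ⟨e ⟨a, ha⟩, fun j => u j.1, ?_⟩
    simp only [Equiv.symm_apply_apply, val]
    congr 1
    rw [hφ, ← Finset.sum_filter_of_ne (p := fun j => g j ≠ 0)]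
    · exact (Finset.sum_subtype _ (by simp) _)
    · intro j _ h1 h2
      exact h1 (by simp [h2])
  · rintro ⟨i, u, rfl⟩
    refine ⟨_, (e.symm i).2, val (fun j : {j : Fin l // g j ≠ 0} => g j.1) u, ?_, rfl⟩
    refine AddSubmonoid.sum_mem _ fun j _ => AddSubmonoid.nsmul_mem _ ?_ _
    exact ⟨_, rfl⟩

lemma FinMod.inter {X Y : Set (ι → ℕ)} (hX : FinMod X) (hY : FinMod Y) : FinMod (X ∩ Y) := by
  classical
  obtain ⟨F, N, hF, hN, rfl⟩ := hX
  obtain ⟨G, K, hG, hK, rfl⟩ := hY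
  obtain ⟨l, φ, rfl⟩ := AddSubmonoid.fg_iff_exists_fin_addMonoidHom.1 hN
  obtain ⟨k, ψ, rfl⟩ := AddSubmonoid.fg_iff_exists_fin_addMonoidHom.1 hK
  let φ' : ((Fin l → ℕ) × (Fin k → ℕ)) →+ (ι → ℕ) := φ.comp (AddMonoidHom.fst _ _)
  let ψ' : ((Fin l → ℕ) × (Fin k → ℕ)) →+ (ι → ℕ) := ψ.comp (AddMonoidHom.snd _ _)
  let S (a b : ι → ℕ) : Set ((Fin l → ℕ) × (Fin k → ℕ)) := {z | a + φ' z = b + ψ' z}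
  let m (a b : ι → ℕ) : Set ((Fin l → ℕ) × (Fin k → ℕ)) := {z | Minimal (· ∈ S a b) z}
  have hm : ∀ a b, (m a b).Finite := fun a b =>
    WellQuasiOrderedLE.finite_of_isAntichain (setOfPred_minimal_antichain _)
  refine ⟨⋃ a ∈ F, ⋃ b ∈ G, (fun z => a + φ' z) '' m a b, (φ'.eqLocusM ψ').map φ', ?_, ?_, ?_⟩
  · exact hF.biUnion fun a _ => hG.biUnion fun b _ => (hm a b).image _
  · exact (AddSubmonoid.fg_eqLocusM φ' ψ').map φ'
  · ext x
    constructor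
    · rintro ⟨⟨a, ha, _, ⟨u, rfl⟩, rfl⟩, ⟨b, hb, _, ⟨v, rfl⟩, hx⟩⟩
      have hz : (u, v) ∈ S a b := hx
      obtain ⟨z, hz1, hz2⟩ := exists_minimal_le_of_wellFoundedLT (· ∈ S a b) (u, v) hz
      obtain ⟨y, hy⟩ := exists_add_of_le hz1
      have hzS : a + φ' z = b + ψ' z := hz2.1
      have hyS : φ' y = ψ' y := by
        have h1 : a + φ' (u, v) = b + ψ' (u, v) := hz
        rw [hy, map_add, map_add, ← add_assoc, ← add_assoc, hzS] at h1
        exact add_left_cancel h1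
      refine ⟨a + φ' z, ?_, φ' y, ⟨y, hyS, rfl⟩, ?_⟩
      · simp only [Set.mem_iUnion]
        exact ⟨a, ha, b, hb, z, hz2, rfl⟩
      · rw [add_assoc, ← map_add, ← hy]; rfl
    · rintro ⟨c, hc, _, ⟨y, hy, rfl⟩, rfl⟩
      simp only [Set.mem_iUnion] at hc
      obtain ⟨a, ha, b, hb, z, hz, rfl⟩ := hc
      have hzS : a + φ' z = b + ψ' z := hz.1
      have hyS : φ' y = ψ' y := hy
      refine ⟨⟨a, ha, φ' (z + y), ⟨_, rfl⟩, ?_⟩, ⟨b, hb, ψ' (z + y), ⟨_, rfl⟩, ?_⟩⟩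
      · rw [map_add, ← add_assoc]
      · change a + φ' z + φ' y = _
        rw [map_add, ← add_assoc, hzS, hyS]

lemma IsLinearSet.finMod' {X : Set (ι → ℕ)} (hX : IsLinearSet X) : FinMod X := by
  rw [isLinearSet_iff_exists_fg_eq_vadd] at hX
  obtain ⟨a, P, hP, rfl⟩ := hX
  refine ⟨{a}, P, Set.finite_singleton a, hP, ?_⟩
  ext x
  simp [Set.mem_vadd_set, eq_comm]

theorem good_semilinear (X : Set (ι → ℕ)) (hX : IsSemilinearSet X) (hFF : FF τ X) :
    Good (cnt τ X) := by
  obtain ⟨S, hS, hS', rfl⟩ := hX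
  refine (good_sUnion {Y | FinMod Y ∧ FF τ Y} ?_ (fun Y h => h.2) ?_ S hS ?_).2.1
  · rintro X ⟨h1, h2⟩ Y ⟨h3, _⟩
    exact ⟨h1.inter h3, h2.mono Set.inter_subset_left⟩
  · rintro X ⟨h1, h2⟩
    exact good_finMod τ X h1 h2
  · intro Y hY
    exact ⟨IsLinearSet.finMod' (hS' Y hY), hFF.mono (Set.subset_sUnion_of_mem hY)⟩
end NatVec
end ECS

namespace ECS
open Polynomial

section Param
variable {ι : Type} [Fintype ι]

lemma sl_aff (a : ι → ℤ) (c : ℤ) :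
    IsSemilinearSet {x : ι → ℕ | ∑ i, a i * (x i : ℤ) + c ≤ 0} := by
  let f : (ι ⊕ Unit → ℕ) →ₗ[ℕ] ℕ :=
    ∑ i, (a i).toNat • LinearMap.proj (R := ℕ) (φ := fun _ => ℕ) (Sum.inl i)
      + LinearMap.proj (Sum.inr ())
  let g : (ι ⊕ Unit → ℕ) →ₗ[ℕ] ℕ :=
    ∑ i, (-a i).toNat • LinearMap.proj (R := ℕ) (φ := fun _ => ℕ) (Sum.inl i)
  have h := (isSemilinearSet_setOfPred_eq c.toNat (-c).toNat f g).proj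
  convert! h using 1
  ext x
  have e : ∑ i, a i * (x i : ℤ) + c =
      ((c.toNat + ∑ i, (a i).toNat * x i : ℕ) : ℤ)
        - (((-c).toNat + ∑ i, (-a i).toNat * x i : ℕ) : ℤ) := by
    have hc : c = (c.toNat : ℤ) - ((-c).toNat : ℤ) := (Int.toNat_sub_toNat_neg c).symm
    have ha : ∑ i, a i * (x i : ℤ)
        = ∑ i, (((a i).toNat : ℤ) - ((-a i).toNat : ℤ)) * (x i : ℤ) := by
      refine Finset.sum_congr rfl fun i _ => ?_
      rw [Int.toNat_sub_toNat_neg]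
    rw [ha]
    conv_lhs => rw [hc]
    push_cast
    simp only [sub_mul, Finset.sum_sub_distrib]
    ring
  have hf : ∀ y : Unit → ℕ, f (Sum.elim x y) = ∑ i, (a i).toNat * x i + y () := by
    intro y; simp [f]
  have hg : ∀ y : Unit → ℕ, g (Sum.elim x y) = ∑ i, (-a i).toNat * x i := by
    intro y; simp [g]
  change (_ : ℤ) ≤ _ ↔ ∃ y : Unit → ℕ, c.toNat + f (Sum.elim x y) = (-c).toNat + g (Sum.elim x y)
  rw [e]
  simp only [hf, hg]
  constructor
  · intro h
    refine ⟨fun _ => ((-c).toNat + ∑ i, (-a i).toNat * x i) - (c.toNat + ∑ i, (a i).toNat * x i), ?_⟩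
    beta_reduce
    omega
  · rintro ⟨y, hy⟩
    omega

lemma sl_lt (i j : ι) : IsSemilinearSet {x : ι → ℕ | x i < x j} := by
  classical
  convert! sl_aff (Pi.single i 1 - Pi.single j 1) 1 using 1
  ext x
  change x i < x j ↔ _ ≤ (0 : ℤ)
  simp only [Pi.sub_apply, sub_mul, Finset.sum_sub_distrib, Pi.single_apply, ite_mul, one_mul,
    zero_mul, Finset.sum_ite_eq', Finset.mem_univ, if_true]
  omega

lemma sl_ne (i j : ι) : IsSemilinearSet {x : ι → ℕ | x i ≠ x j} := by
  convert! (sl_lt i j).union (sl_lt j i) using 1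
  ext x
  change x i ≠ x j ↔ x i < x j ∨ x j < x i
  omega

/-- The domain: all coordinates are bounded by the parameter coordinate, which is positive. -/
def Dom (i₀ : ι) : Set (ι → ℕ) := {x | 1 ≤ x i₀ ∧ ∀ i, x i ≤ x i₀}

lemma sl_dom (i₀ : ι) : IsSemilinearSet (Dom i₀) := by
  classical
  convert! (sl_aff (-Pi.single i₀ 1) 1).inter
    (IsSemilinearSet.iInter fun i => (sl_lt i₀ i).compl) using 1
  ext x
  simp only [Dom, Set.mem_inter_iff, Set.mem_iInter, Set.mem_compl_iff, Set.mem_ofPred_eq, not_lt]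
  refine and_congr_left fun _ => ?_
  simp only [Pi.neg_apply, neg_mul, Finset.sum_neg_distrib, Pi.single_apply, ite_mul, one_mul,
    zero_mul, Finset.sum_ite_eq', Finset.mem_univ, if_true]
  omega

lemma sl_base (i₀ : ι) (d : ℕ) (a : ℕ → ι → ℤ) (c : ℕ → ℤ) (e : ℤ) :
    IsSemilinearSet (Dom i₀ ∩ {x : ι → ℕ |
      e + ∑ k ∈ Finset.range d, (x i₀ : ℤ) ^ k * (∑ i, a k i * (x i : ℤ) + c k) ≤ 0}) := by
  classical
  induction d generalizing a c e with
  | zero =>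
    by_cases he : e ≤ 0
    · simpa [he] using sl_dom i₀
    · simp [he]
  | succ d ih =>
    set B : ℤ := |e| + (∑ i, |a 0 i| + |c 0|) + 1 with hB
    have h : ∀ e' : ℤ, IsSemilinearSet
        ({x : ι → ℕ | ∑ i, ((e' - 1) • (Pi.single i₀ 1 : ι → ℤ) - a 0) i * (x i : ℤ)
            + (1 - e - c 0) ≤ 0} ∩
         ({x : ι → ℕ | ∑ i, (a 0 - e' • (Pi.single i₀ 1 : ι → ℤ)) i * (x i : ℤ) + (e + c 0) ≤ 0} ∩
          (Dom i₀ ∩ {x : ι → ℕ | e' + ∑ k ∈ Finset.range d,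
            (x i₀ : ℤ) ^ k * (∑ i, a (k + 1) i * (x i : ℤ) + c (k + 1)) ≤ 0}))) := fun e' =>
      (sl_aff _ _).inter ((sl_aff _ _).inter (ih (fun k => a (k + 1)) (fun k => c (k + 1)) e'))
    convert! IsSemilinearSet.biUnion (Set.finite_Icc (-B) B) (fun e' _ => h e') using 1
    ext x
    simp only [Set.mem_iUnion, Set.mem_inter_iff, Set.mem_ofPred_eq, Finset.sum_range_succ',
      pow_zero, one_mul, Pi.sub_apply, Pi.smul_apply, smul_eq_mul, sub_mul,
      Finset.sum_sub_distrib, Pi.single_apply, mul_ite, ite_mul, mul_one, mul_zero, zero_mul,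
      Finset.sum_ite_eq', Finset.mem_univ, if_true, exists_prop]
    set S : ℤ := ∑ k ∈ Finset.range d,
            (x i₀ : ℤ) ^ k * (∑ i, a (k + 1) i * (x i : ℤ) + c (k + 1)) with hS
    have hS' : ∑ k ∈ Finset.range d,
            (x i₀ : ℤ) ^ (k + 1) * (∑ i, a (k + 1) i * (x i : ℤ) + c (k + 1)) = (x i₀ : ℤ) * S := by
      rw [hS, Finset.mul_sum]
      refine Finset.sum_congr rfl fun k _ => ?_
      ring
    rw [hS']
    set g : ℤ := ∑ i, a 0 i * (x i : ℤ) with hg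
    set t : ℤ := (x i₀ : ℤ) with ht
    constructor
    · rintro ⟨hD, hle⟩
      have ht1 : 1 ≤ t := by have := hD.1; omega
      have hgb : |g| ≤ (∑ i, |a 0 i|) * t := by
        rw [hg, Finset.sum_mul]
        refine (Finset.abs_sum_le_sum_abs _ _).trans (Finset.sum_le_sum fun i _ => ?_)
        rw [abs_mul]
        refine mul_le_mul_of_nonneg_left ?_ (abs_nonneg _)
        have := hD.2 i
        rw [abs_of_nonneg (by positivity)]
        omega
      have hb : |e + g + c 0| ≤ (B - 1) * t := by
        have h1 : |e + g + c 0| ≤ |e| + |g| + |c 0| := abs_add_three _ _ _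
        have h2 : |e| ≤ |e| * t := le_mul_of_one_le_right (abs_nonneg _) ht1
        have h3 : |c 0| ≤ |c 0| * t := le_mul_of_one_le_right (abs_nonneg _) ht1
        have : (B - 1) * t = |e| * t + (∑ i, |a 0 i|) * t + |c 0| * t := by rw [hB]; ring
        linarith
      obtain ⟨hb1, hb2⟩ := abs_le.1 hb
      set v := e + g + c 0 with hv
      obtain ⟨e', h1, h2⟩ : ∃ e' : ℤ, (e' - 1) * t < v ∧ v ≤ e' * t := by
        refine ⟨-((-v) / t), ?_, ?_⟩
        · have := Int.lt_ediv_add_one_mul_self (-v) (by omega : 0 < t)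
          nlinarith
        · have := Int.ediv_mul_le (-v) (by omega : t ≠ 0)
          nlinarith
      refine ⟨e', ⟨?_, ?_⟩, ?_, ?_, hD, ?_⟩
      · by_contra hc
        have : e' + 1 ≤ -B := by omega
        nlinarith
      · by_contra hc
        have : B ≤ e' - 1 := by omega
        nlinarith
      · linarith
      · linarith
      · by_contra hc
        have : 1 ≤ e' + S := by omega
        nlinarith
    · rintro ⟨e', _, h1, h2, hD, h3⟩
      refine ⟨hD, ?_⟩
      have ht1 : 1 ≤ t := by have := hD.1; omega
      nlinarith

lemma sl_poly (i₀ : ι) (P : ι → ℤ[X]) (Q : ℤ[X]) :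
    IsSemilinearSet (Dom i₀ ∩ {x : ι → ℕ |
      ∑ i, (P i).eval (x i₀ : ℤ) * (x i : ℤ) ≤ Q.eval (x i₀ : ℤ)}) := by
  set d := ∑ i, (P i).natDegree + Q.natDegree + 1 with hd
  have h := sl_base i₀ d (fun k i => (P i).coeff k) (fun k => - Q.coeff k) 0
  convert! h using 1
  ext x
  refine and_congr_right fun _ => ?_
  change (_ : ℤ) ≤ _ ↔ _ ≤ (0 : ℤ)
  have h1 : ∀ i, (P i).eval (x i₀ : ℤ) = ∑ k ∈ Finset.range d, (P i).coeff k * (x i₀ : ℤ) ^ k := by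
    intro i
    refine eval_eq_sum_range' ?_ _
    have := Finset.single_le_sum (f := fun i => (P i).natDegree) (fun _ _ => Nat.zero_le _)
      (Finset.mem_univ i)
    omega
  have h2 : Q.eval (x i₀ : ℤ) = ∑ k ∈ Finset.range d, Q.coeff k * (x i₀ : ℤ) ^ k :=
    eval_eq_sum_range' (by omega) _
  have h3 : ∑ k ∈ Finset.range d, (x i₀ : ℤ) ^ k * (∑ i, (P i).coeff k * (x i : ℤ) + - Q.coeff k)
      = ∑ i, (P i).eval (x i₀ : ℤ) * (x i : ℤ) - Q.eval (x i₀ : ℤ) := by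
    simp only [h1, h2, mul_add, Finset.sum_add_distrib, Finset.mul_sum, Finset.sum_mul]
    rw [Finset.sum_comm, sub_eq_add_neg, ← Finset.sum_neg_distrib]
    congr 1
    · refine Finset.sum_congr rfl fun i _ => Finset.sum_congr rfl fun k _ => ?_
      ring
    · refine Finset.sum_congr rfl fun k _ => ?_
      ring
  rw [zero_add, h3]
  omega

lemma sl_poly_eq (i₀ : ι) (P : ι → ℤ[X]) (Q : ℤ[X]) :
    IsSemilinearSet (Dom i₀ ∩ {x : ι → ℕ |
      ∑ i, (P i).eval (x i₀ : ℤ) * (x i : ℤ) = Q.eval (x i₀ : ℤ)}) := by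
  convert! (sl_poly i₀ P Q).inter (sl_poly i₀ (fun i => - P i) (-Q)) using 1
  ext x
  simp only [Set.mem_inter_iff, Set.mem_ofPred_eq, eval_neg, neg_mul, Finset.sum_neg_distrib,
    neg_le_neg_iff]
  constructor
  · rintro ⟨h, h'⟩
    exact ⟨⟨h, h'.le⟩, h, h'.ge⟩
  · rintro ⟨⟨h, h1⟩, _, h2⟩
    exact ⟨h, le_antisymm h1 h2⟩

end Param
end ECS

namespace ECS
open Polynomial

section Final
variable {n1 n2 p q : ℕ} (m : ℕ) {S : Type}
    (A1 : Matrix (Fin q) (Fin n2 ⊕ Fin n1) ℤ) (bb : S → Fin q → Polynomial ℤ)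
    (A2 : Matrix (Fin p) (Fin n2) (Polynomial ℤ)) (b2 : Fin p → Polynomial ℤ)

/-- `m` distinct points of the union of the `K(α,t)` over the first coordinates. -/
def Tset : Set (((Fin n2 ⊕ Unit) ⊕ (Fin m × Fin n1)) → ℕ) :=
  Dom (Sum.inl (Sum.inr ())) ∩ {z |
    (∀ k j, z (Sum.inr (k, j)) < z (Sum.inl (Sum.inr ()))) ∧
    (∀ k k', k ≠ k' → ∃ j, z (Sum.inr (k, j)) ≠ z (Sum.inr (k', j))) ∧
    ∀ k, ∃ α, ∀ i, ∑ j, A1 i (Sum.inl j) * (z (Sum.inl (Sum.inl j)) : ℤ)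
      + ∑ j, A1 i (Sum.inr j) * (z (Sum.inr (k, j)) : ℤ)
      = (bb α i).eval (z (Sum.inl (Sum.inr ())) : ℤ)}

lemma sl_Tset [Finite S] : IsSemilinearSet (Tset m A1 bb) := by
  classical
  let i₀ : (Fin n2 ⊕ Unit) ⊕ (Fin m × Fin n1) := Sum.inl (Sum.inr ())
  let P : Fin m → Fin q → (Fin n2 ⊕ Unit) ⊕ (Fin m × Fin n1) → ℤ[X] := fun k i =>
    Sum.elim (Sum.elim (fun j => C (A1 i (Sum.inl j))) (fun _ => 0))
      (fun kj => if kj.1 = k then C (A1 i (Sum.inr kj.2)) else 0)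
  have h1 : IsSemilinearSet (⋂ k : Fin m, ⋂ j : Fin n1,
      {z : (Fin n2 ⊕ Unit) ⊕ (Fin m × Fin n1) → ℕ | z (Sum.inr (k, j)) < z i₀}) :=
    .iInter fun k => .iInter fun j => sl_lt _ _
  have h2 : IsSemilinearSet (⋂ kk : {kk : Fin m × Fin m // kk.1 ≠ kk.2}, ⋃ j : Fin n1,
      {z : (Fin n2 ⊕ Unit) ⊕ (Fin m × Fin n1) → ℕ |
        z (Sum.inr (kk.1.1, j)) ≠ z (Sum.inr (kk.1.2, j))}) :=
    .iInter fun kk => .iUnion fun j => sl_ne _ _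
  have h3 : IsSemilinearSet (⋂ k : Fin m, ⋃ α : S, ⋂ i : Fin q, (Dom i₀ ∩
      {z : (Fin n2 ⊕ Unit) ⊕ (Fin m × Fin n1) → ℕ |
        ∑ l, (P k i l).eval (z i₀ : ℤ) * (z l : ℤ) = (bb α i).eval (z i₀ : ℤ)})) :=
    .iInter fun k => .iUnion fun α => .iInter fun i => sl_poly_eq i₀ _ _
  have hP : ∀ k i (z : (Fin n2 ⊕ Unit) ⊕ (Fin m × Fin n1) → ℕ),
      ∑ l, (P k i l).eval (z i₀ : ℤ) * (z l : ℤ) =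
      ∑ j, A1 i (Sum.inl j) * (z (Sum.inl (Sum.inl j)) : ℤ)
      + ∑ j, A1 i (Sum.inr j) * (z (Sum.inr (k, j)) : ℤ) := by
    intro k i z
    rw [Fintype.sum_sum_type, Fintype.sum_sum_type, Fintype.sum_prod_type]
    simp only [P, Sum.elim_inl, Sum.elim_inr, eval_C, eval_zero, zero_mul, Finset.sum_const_zero,
      add_zero]
    congr 1
    rw [Finset.sum_eq_single k]
    · simp
    · intro b _ hb
      simp [hb]
    · simp
  convert! ((sl_dom i₀).inter h1).inter (h2.inter h3) using 1
  ext z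
  simp only [Tset, Set.mem_inter_iff, Set.mem_iInter, Set.mem_iUnion, Set.mem_ofPred_eq, and_assoc]
  refine and_congr_right fun hz => and_congr_right fun _ => and_congr ?_ ?_
  · constructor
    · intro h kk
      exact h _ _ kk.2
    · intro h k k' hk
      exact h ⟨(k, k'), hk⟩
  · refine forall_congr' fun k => exists_congr fun α => forall_congr' fun i => ?_
    exact ⟨fun h => ⟨hz, (hP k i z).trans h⟩, fun h => (hP k i z).symm.trans h.2⟩

/-- The set whose `t`-fibres are the `L₃(t)`. -/
def Pset : Set (Fin n2 ⊕ Unit → ℕ) :=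
  (Dom (Sum.inr ()) ∩ {x | ∀ i, ∑ j, (A2 i j).eval (x (Sum.inr ()) : ℤ) * (x (Sum.inl j) : ℤ)
      ≤ (b2 i).eval (x (Sum.inr ()) : ℤ)}) ∩
    {x | ∃ y, Sum.elim x y ∈ Tset m A1 bb}ᶜ

lemma sl_Pset [Finite S] : IsSemilinearSet (Pset m A1 bb A2 b2) := by
  have h1 : IsSemilinearSet (⋂ i : Fin p, (Dom (Sum.inr ()) ∩
      {x : Fin n2 ⊕ Unit → ℕ |
        ∑ l, (Sum.elim (fun j => A2 i j) (fun _ => 0) l : ℤ[X]).eval (x (Sum.inr ()) : ℤ)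
          * (x l : ℤ) ≤ (b2 i).eval (x (Sum.inr ()) : ℤ)})) :=
    .iInter fun i => sl_poly (Sum.inr ()) _ _
  refine IsSemilinearSet.inter ?_ (sl_Tset m A1 bb).proj.compl
  convert! (sl_dom (Sum.inr ())).inter h1 using 1
  ext x
  simp only [Set.mem_inter_iff, Set.mem_iInter, Set.mem_ofPred_eq, Fintype.sum_sum_type,
    Sum.elim_inl, Sum.elim_inr, eval_zero, zero_mul, Finset.sum_const_zero, add_zero]
  refine and_congr_right fun hz => forall_congr' fun i => ?_
  exact ⟨fun h => ⟨hz, h⟩, fun h => h.2⟩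

/-- The parameter. -/
def tauHom (n2 : ℕ) : (Fin n2 ⊕ Unit → ℕ) →+ ℕ :=
  Pi.evalAddMonoidHom (fun _ => ℕ) (Sum.inr ())

lemma ff_Pset : FF (tauHom n2) (Pset m A1 bb A2 b2) := by
  intro t
  refine (Set.finite_Iic (fun _ : Fin n2 ⊕ Unit => t)).subset ?_
  rintro x ⟨⟨⟨hx, _⟩, _⟩, ht⟩ i
  have ht' : x (Sum.inr ()) = t := ht
  exact ht' ▸ hx.2 i

lemma le_ncard_iff {β : Type*} {s : Set β} (hs : s.Finite) (m : ℕ) :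
    m ≤ s.ncard ↔ ∃ g : Fin m → β, Function.Injective g ∧ ∀ k, g k ∈ s := by
  constructor
  · intro h
    obtain ⟨u, hu, hc⟩ := Set.exists_subset_card_eq h
    have hf : u.Finite := hs.subset hu
    have : Finite u := hf
    have e : u ≃ Fin m := Finite.equivFinOfCardEq (by rw [← hc]; rfl)
    exact ⟨fun k => (e.symm k : β), fun a b hab => e.symm.injective (Subtype.ext hab),
      fun k => hu (e.symm k).2⟩
  · rintro ⟨g, hg, hgs⟩
    have h1 : (Set.range g).ncard ≤ s.ncard :=
      Set.ncard_le_ncard (by rintro _ ⟨k, rfl⟩; exact hgs k) hs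
    have h2 : (Set.range g).ncard = m := by
      rw [← Set.image_univ, Set.ncard_image_of_injective _ hg, Set.ncard_univ, Nat.card_fin]
    omega

lemma mem_T_iff {t : ℕ} (ht : 1 ≤ t) (x : Fin n2 ⊕ Unit → ℕ) (hxt : x (Sum.inr ()) = t)
    (hx : ∀ j, x (Sum.inl j) < t) :
    (∃ y, Sum.elim x y ∈ Tset m A1 bb) ↔
    m ≤ {y3 : Fin n1 → ℤ | (∀ j, 0 ≤ y3 j ∧ y3 j ≤ (t : ℤ) - 1) ∧
      ∃ α : S, Sum.elim (fun j => (x (Sum.inl j) : ℤ)) y3 ∈ Kset A1 (bb α) t}.ncard := by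
  rw [le_ncard_iff]
  · constructor
    · rintro ⟨y, hD, h1, h2, h3⟩
      simp only [Sum.elim_inl, Sum.elim_inr, hxt] at h1 h2 h3
      refine ⟨fun k j => (y (k, j) : ℤ), ?_, ?_⟩
      · intro k k' hk
        by_contra hne
        obtain ⟨j, hj⟩ := h2 k k' hne
        apply hj
        have hkj := congrFun hk j
        simp only at hkj
        exact_mod_cast hkj
      · intro k
        have hb : ∀ j, (0 : ℤ) ≤ y (k, j) ∧ (y (k, j) : ℤ) ≤ (t : ℤ) - 1 := by
          intro j
          have := h1 k j
          omega
        refine ⟨hb, ?_⟩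
        obtain ⟨α, hα⟩ := h3 k
        refine ⟨α, ?_, ?_⟩
        · rintro (j | j)
          · have := hx j
            simp only [Sum.elim_inl]
            omega
          · exact hb j
        · intro i
          rw [Fintype.sum_sum_type]
          exact hα i
    · rintro ⟨g, hg, hgs⟩
      have hb : ∀ k j, 0 ≤ g k j ∧ g k j ≤ (t : ℤ) - 1 := fun k => (hgs k).1
      have hc : ∀ k j, ((g k j).toNat : ℤ) = g k j := fun k j => Int.toNat_of_nonneg (hb k j).1
      refine ⟨fun kj => (g kj.1 kj.2).toNat, ⟨?_, ?_⟩, ?_, ?_, ?_⟩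
      · simp only [Sum.elim_inl, hxt]; exact ht
      · rintro ((j | j) | ⟨k, j⟩)
        · simp only [Sum.elim_inl, hxt]; exact (hx j).le
        · exact le_rfl
        · simp only [Sum.elim_inl, Sum.elim_inr, hxt]
          have := hb k j
          omega
      · intro k j
        simp only [Sum.elim_inl, Sum.elim_inr, hxt]
        have := hb k j
        omega
      · intro k k' hne
        by_contra hcon
        push Not at hcon
        apply hne
        apply hg
        funext j
        have := hcon j
        simp only [Sum.elim_inr] at this
        rw [← hc k j, ← hc k' j, this]
      · intro k
        obtain ⟨α, _, hα⟩ := (hgs k).2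
        refine ⟨α, fun i => ?_⟩
        have := hα i
        rw [Fintype.sum_sum_type] at this
        simp only [Sum.elim_inl, Sum.elim_inr, hxt, hc] at this ⊢
        exact this
  · refine (Set.finite_Icc (fun _ : Fin n1 => (0 : ℤ)) (fun _ => (t : ℤ) - 1)).subset ?_
    rintro y ⟨hy, _⟩
    exact ⟨fun j => (hy j).1, fun j => (hy j).2⟩

lemma card_eq {t : ℕ} (ht : 1 ≤ t)
    (hsub : ∀ x : Fin n2 → ℝ,
      (∀ i, ∑ j, (evalAt (A2 i j) t : ℝ) * x j ≤ (evalAt (b2 i) t : ℝ)) →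
      ∀ j, 0 ≤ x j ∧ x j ≤ (t : ℝ) - 1) :
    ((latticeL3K m A1 bb A2 b2 t).ncard : ℚ) = cnt (tauHom n2) (Pset m A1 bb A2 b2) t := by
  have hbox : ∀ y : Fin n2 → ℤ, y ∈ latticeL2 A2 b2 t → ∀ j, 0 ≤ y j ∧ y j < t := by
    intro y hy j
    have := hsub (fun j => (y j : ℝ)) (fun i => by exact_mod_cast hy i) j
    have h1 : (0 : ℤ) ≤ y j := by exact_mod_cast this.1
    have h2 : (y j : ℝ) + 1 ≤ t := by linarith [this.2]
    have h3 : y j + 1 ≤ t := by exact_mod_cast h2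
    omega
  unfold cnt
  congr 1
  symm
  refine Set.ncard_congr (fun x _ => fun j => (x (Sum.inl j) : ℤ)) ?_ ?_ ?_
  · rintro x ⟨⟨⟨hD, hx⟩, hT⟩, hxt⟩
    replace hxt : x (Sum.inr ()) = t := hxt
    have h2 : (fun j => (x (Sum.inl j) : ℤ)) ∈ latticeL2 A2 b2 t := by
      intro i
      have := hx i
      rw [hxt] at this
      exact this
    refine ⟨h2, ?_⟩
    by_contra hcon
    exact hT ((mem_T_iff m A1 bb ht x hxt fun j => by
      exact_mod_cast (hbox _ h2 j).2).2 (not_lt.1 hcon))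
  · rintro x x' ⟨_, hx⟩ ⟨_, hx'⟩ h
    funext l
    rcases l with j | j
    · exact_mod_cast congrFun h j
    · have h1 : x (Sum.inr ()) = t := hx
      have h2 : x' (Sum.inr ()) = t := hx'
      exact h1.trans h2.symm
  · rintro y ⟨hy, hc⟩
    have hb := hbox y hy
    have hn : ∀ j, ((y j).toNat : ℤ) = y j := fun j => Int.toNat_of_nonneg (hb j).1
    refine ⟨Sum.elim (fun j => (y j).toNat) (fun _ => t), ⟨⟨⟨⟨ht, ?_⟩, ?_⟩, ?_⟩, rfl⟩, ?_⟩
    · rintro (j | j)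
      · have := hb j
        simp only [Sum.elim_inl, Sum.elim_inr]
        omega
      · exact le_rfl
    · intro i
      simp only [Sum.elim_inl, Sum.elim_inr, hn]
      exact hy i
    · intro hT
      have := (mem_T_iff m A1 bb ht _ rfl (fun j => by
        have := hb j
        simp only [Sum.elim_inl]
        omega)).1 hT
      simp only [Sum.elim_inl, hn] at this
      exact absurd hc (not_lt.2 this)
    · funext j
      exact hn j

end Final
end ECS

/-- exclusion-type problem with constant matrix `A₁` and finitely many
disjoint sets `K(α,t)`: the size function `g(t) = |L₃(t)|` is eventually
quasi-polynomial. -/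
theorem exclusion_constant_size_eqp (m n1 n2 p q : ℕ)
    (hm : 0 < m) (hn1 : 0 < n1) (hn2 : 0 < n2) (hp : 0 < p) (hq : 0 < q)
    (A1 : Matrix (Fin q) (Fin n2 ⊕ Fin n1) ℤ)
    (A2 : Matrix (Fin p) (Fin n2) (Polynomial ℤ)) (b2 : Fin p → Polynomial ℤ)
    (S : Type) [Fintype S] (bb : S → Fin q → Polynomial ℤ)
    (hsub : ∀ t : ℕ, 0 < t → ∀ x : Fin n2 → ℝ,
      (∀ i, ∑ j, (evalAt (A2 i j) t : ℝ) * x j ≤ (evalAt (b2 i) t : ℝ)) →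
      ∀ j, 0 ≤ x j ∧ x j ≤ (t : ℝ) - 1)
    (hdisj : ∀ t : ℕ, 0 < t → ∀ α β : S, α ≠ β →
      Disjoint (Kset A1 (bb α) t) (Kset A1 (bb β) t)) :
    IsEQP (fun t => ((latticeL3K m A1 bb A2 b2 t).ncard : ℤ)) := by
  apply ECS.Good.isEQP
  apply ECS.Good.of_shift 1
  have h := (ECS.good_semilinear (ECS.tauHom n2) _ (ECS.sl_Pset m A1 bb A2 b2)
    (ECS.ff_Pset m A1 bb A2 b2)).shift 1
  convert! h using 1
  funext t
  rw [← ECS.card_eq m A1 bb A2 b2 (Nat.succ_le_succ (Nat.zero_le t))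
    (hsub (t + 1) (Nat.succ_pos t))]
  simp
end
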